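/- Let G be a simple graph on a finite vertex type α, let v_odd(G) be the number of vertices of odd degree in G (an even number), let Δ(G) be the maximum degree of G, and let Δ_e(G) := 2⌈Δ(G)/2⌉. Then G admits a path odd-cover of size at most max{ v_odd(G)/2, ⌈(v_odd(G)/2 + 3Δ_e(G))/4⌉ }. In particular, if every vertex of G has even degree, then G admits a path odd-cover of size at most ⌈3Δ(G)/4⌉. -/

import Mathlib

/-- The degree of a vertex, as the cardinality of its neighbor set. -/
noncomputable def degS {α : Type*} (G : SimpleGraph α) (v : α) : ℕ := (G.neighborSet v).ncard

/-- A polycycle: every vertex has degree 0 or 2 (every component is a cycle). -/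
def IsPolycycle {α : Type*} (G : SimpleGraph α) : Prop :=
  ∀ v, degS G v = 0 ∨ degS G v = 2

/-- A cycle graph: a nonempty connected graph in which every non-isolated vertex
has degree 2. -/
def IsCycleGraph {α : Type*} (G : SimpleGraph α) : Prop :=
  G ≠ ⊥ ∧ (∀ v, degS G v = 0 ∨ degS G v = 2) ∧
    ∀ u v, 0 < degS G u → 0 < degS G v → G.Reachable u v

/-- A path graph: a graph whose edge set forms a nontrivial path. -/
def IsPathGraph {α : Type*} (G : SimpleGraph α) : Prop :=
  G ≠ ⊥ ∧ G.IsAcyclic ∧ (∀ v, degS G v ≤ 2) ∧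
    ∀ u v, 0 < degS G u → 0 < degS G v → G.Reachable u v

/-- A linear forest: an acyclic graph of maximum degree at most 2. -/
def IsLinearForest {α : Type*} (G : SimpleGraph α) : Prop :=
  G.IsAcyclic ∧ ∀ v, degS G v ≤ 2

/-- The symmetric difference of a family (list) of graphs: an edge belongs to it
iff it belongs to an odd number of members. -/
def listSymmDiff {α : Type*} (L : List (SimpleGraph α)) : SimpleGraph α :=
  L.foldr symmDiff ⊥

/-- The number of vertices of odd degree. -/
noncomputable def vodd {α : Type*} (G : SimpleGraph α) : ℕ :=
  {v | Odd (degS G v)}.ncard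

/-- The maximum degree of a graph on a finite vertex type. -/
noncomputable def maxDegS {α : Type*} [Fintype α] (G : SimpleGraph α) : ℕ :=
  Finset.univ.sup (degS G)

/-- The smallest even integer that is at least the maximum degree. -/
noncomputable def deltaE {α : Type*} [Fintype α] (G : SimpleGraph α) : ℕ :=
  2 * ((maxDegS G + 1) / 2)

namespace PathOddCover
section
open scoped symmDiff
variable {α : Type*}

theorem symmDiff_adj {G H : SimpleGraph α} {x y : α} :
    (G ∆ H).Adj x y ↔ (G.Adj x y ∧ ¬ H.Adj x y) ∨ (H.Adj x y ∧ ¬ G.Adj x y) := by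
  simp [symmDiff, SimpleGraph.sdiff_adj]

theorem edge_adj' {u v x y : α} (h : u ≠ v) :
    (SimpleGraph.edge u v).Adj x y ↔ (x = u ∧ y = v) ∨ (x = v ∧ y = u) := by
  rw [SimpleGraph.edge_adj]
  constructor
  · rintro ⟨h1 | h1, _⟩ <;> aesop
  · rintro (⟨rfl, rfl⟩ | ⟨rfl, rfl⟩) <;> simp [h, h.symm]

theorem flip_adj {G : SimpleGraph α} {u v x y : α} (h : u ≠ v) :
    (G ∆ SimpleGraph.edge u v).Adj x y ↔
      (G.Adj x y ↔ ¬ ((x = u ∧ y = v) ∨ (x = v ∧ y = u))) := by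
  rw [symmDiff_adj, edge_adj' h]; tauto

theorem flip_adj_of_ne {G : SimpleGraph α} {u v x y : α} (h : u ≠ v) (hu : x ≠ u) (hv : x ≠ v) :
    (G ∆ SimpleGraph.edge u v).Adj x y ↔ G.Adj x y := by
  rw [flip_adj h]; tauto

theorem neighborSet_symmDiff (G H : SimpleGraph α) (v : α) :
    (G ∆ H).neighborSet v = G.neighborSet v ∆ H.neighborSet v := by
  ext w; simp [symmDiff_adj, Set.mem_symmDiff]

theorem degS_congr {G H : SimpleGraph α} {v : α} (h : ∀ y, G.Adj v y ↔ H.Adj v y) :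
    degS G v = degS H v := by
  unfold degS; congr 1; ext y; simp [h]

theorem degS_eq_zero_iff [Finite α] {G : SimpleGraph α} {v : α} :
    degS G v = 0 ↔ ∀ y, ¬ G.Adj v y := by
  unfold degS
  rw [Set.ncard_eq_zero]
  simp [Set.eq_empty_iff_forall_notMem]

theorem degS_pos_iff [Finite α] {G : SimpleGraph α} {v : α} : 0 < degS G v ↔ ∃ y, G.Adj v y := by
  rw [Nat.pos_iff_ne_zero, Ne, degS_eq_zero_iff]; simp

theorem degS_le_one_iff [Finite α] {G : SimpleGraph α} {v : α} :
    degS G v ≤ 1 ↔ ∀ y z, G.Adj v y → G.Adj v z → y = z := by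
  unfold degS
  rw [Set.ncard_le_one]
  simp only [SimpleGraph.mem_neighborSet]
  exact ⟨fun h y z hy hz => h y hy z hz, fun h y hy z hz => h y z hy hz⟩

theorem degS_eq_two_iff {G : SimpleGraph α} {v : α} :
    degS G v = 2 ↔ ∃ a b, a ≠ b ∧ ∀ y, G.Adj v y ↔ (y = a ∨ y = b) := by
  unfold degS
  rw [Set.ncard_eq_two]
  constructor
  · rintro ⟨a, b, hab, h⟩
    refine ⟨a, b, hab, fun y => ?_⟩
    have := Set.ext_iff.1 h y
    simpa using this
  · rintro ⟨a, b, hab, h⟩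
    exact ⟨a, b, hab, by ext y; simpa using h y⟩

theorem degS_eq_one_iff {G : SimpleGraph α} {v : α} :
    degS G v = 1 ↔ ∃ a, ∀ y, G.Adj v y ↔ y = a := by
  unfold degS
  rw [Set.ncard_eq_one]
  constructor
  · rintro ⟨a, h⟩
    refine ⟨a, fun y => ?_⟩
    have := Set.ext_iff.1 h y
    simpa using this
  · rintro ⟨a, h⟩
    exact ⟨a, by ext y; simpa using h y⟩

theorem degS_mono [Finite α] {G H : SimpleGraph α} (h : G ≤ H) (v : α) : degS G v ≤ degS H v :=
  Set.ncard_le_ncard (fun _ hy => h hy)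

theorem degS_flip_of_ne {G : SimpleGraph α} {u v w : α} (h : u ≠ v) (hu : w ≠ u) (hv : w ≠ v) :
    degS (G ∆ SimpleGraph.edge u v) w = degS G w :=
  degS_congr fun _ => flip_adj_of_ne h hu hv

theorem degS_flip_add [Finite α] {G : SimpleGraph α} {u v : α} (h : u ≠ v) (hn : ¬ G.Adj u v) :
    degS (G ∆ SimpleGraph.edge u v) u = degS G u + 1 := by
  unfold degS
  rw [← Set.ncard_insert_of_notMem (s := G.neighborSet u) (a := v) (by simpa using hn)]
  congr 1; ext y
  simp only [SimpleGraph.mem_neighborSet, flip_adj h, Set.mem_insert_iff]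
  constructor
  · intro h'; by_cases hy : y = v
    · exact Or.inl hy
    · right; exact h'.2 (by rintro (⟨_, h2⟩ | ⟨h2, _⟩); exacts [hy h2, h h2])
  · rintro (rfl | h')
    · simp [hn]
    · have hy : y ≠ v := by rintro rfl; exact hn h'
      simp [h', hy, h]

theorem degS_flip_sub [Finite α] {G : SimpleGraph α} {u v : α} (hn : G.Adj u v) :
    degS (G ∆ SimpleGraph.edge u v) u + 1 = degS G u := by
  have h := hn.ne
  have := degS_flip_add (G := G ∆ SimpleGraph.edge u v) h (by rw [flip_adj h]; simp [hn])
  rw [symmDiff_symmDiff_cancel_right] at this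
  exact this.symm

theorem flip_comm (G : SimpleGraph α) (u v : α) :
    G ∆ SimpleGraph.edge u v = G ∆ SimpleGraph.edge v u := by
  rw [SimpleGraph.edge_comm]

theorem degS_flip_add' [Finite α] {G : SimpleGraph α} {u v : α} (h : u ≠ v) (hn : ¬ G.Adj u v) :
    degS (G ∆ SimpleGraph.edge u v) v = degS G v + 1 := by
  rw [flip_comm]; exact degS_flip_add h.symm (fun h' => hn h'.symm)

theorem degS_flip_sub' [Finite α] {G : SimpleGraph α} {u v : α} (hn : G.Adj u v) :
    degS (G ∆ SimpleGraph.edge u v) v + 1 = degS G v := by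
  rw [flip_comm]; exact degS_flip_sub hn.symm

theorem flip_le {G : SimpleGraph α} {u v : α} (hn : G.Adj u v) : G ∆ SimpleGraph.edge u v ≤ G := by
  intro x y
  rw [flip_adj hn.ne]
  intro h
  by_contra hc
  have : (x = u ∧ y = v) ∨ (x = v ∧ y = u) := by tauto
  rcases this with ⟨rfl, rfl⟩ | ⟨rfl, rfl⟩
  · exact hc hn
  · exact hc hn.symm

theorem le_flip {G : SimpleGraph α} {u v : α} (h : u ≠ v) (hn : ¬ G.Adj u v) :
    G ≤ G ∆ SimpleGraph.edge u v := by
  have := flip_le (G := G ∆ SimpleGraph.edge u v) (u := u) (v := v) (by rw [flip_adj h]; simp [hn])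
  rwa [symmDiff_symmDiff_cancel_right] at this

/-- The set of vertices of odd degree. -/
def oddSet (G : SimpleGraph α) : Set α := {v | Odd (degS G v)}

theorem mem_oddSet {G : SimpleGraph α} {v : α} : v ∈ oddSet G ↔ Odd (degS G v) := Iff.rfl

theorem odd_ncard_symmDiff [Finite α] (s t : Set α) :
    Odd (s ∆ t).ncard ↔ (Odd s.ncard ↔ ¬ Odd t.ncard) := by
  have h1 : (s ∆ t).ncard = (s \ t).ncard + (t \ s).ncard := by
    rw [Set.symmDiff_def]
    exact Set.ncard_union_eq disjoint_sdiff_sdiff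
  have h2 := Set.ncard_inter_add_ncard_sdiff_eq_ncard s t
  have h3 := Set.ncard_inter_add_ncard_sdiff_eq_ncard t s
  rw [Set.inter_comm t s] at h3
  rw [h1, ← h2, ← h3]
  simp only [Nat.odd_iff]
  omega

theorem oddSet_symmDiff [Finite α] (G H : SimpleGraph α) :
    oddSet (G ∆ H) = oddSet G ∆ oddSet H := by
  ext v
  rw [Set.mem_symmDiff]
  simp only [mem_oddSet]
  unfold degS
  rw [neighborSet_symmDiff, odd_ncard_symmDiff]
  tauto

theorem oddSet_edge {u v : α} (h : u ≠ v) : oddSet (SimpleGraph.edge u v) = {u, v} := by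
  ext w
  simp only [mem_oddSet, Set.mem_insert_iff, Set.mem_singleton_iff]
  by_cases hu : w = u
  · subst hu
    have : degS (SimpleGraph.edge w v) w = 1 :=
      degS_eq_one_iff.2 ⟨v, fun y => by rw [edge_adj' h]; simp [h]⟩
    simp [this]
  by_cases hv : w = v
  · subst hv
    have : degS (SimpleGraph.edge u w) w = 1 :=
      degS_eq_one_iff.2 ⟨u, fun y => by rw [edge_adj' h]; simp [h.symm]⟩
    simp [this]
  have : degS (SimpleGraph.edge u v) w = 0 := by
    unfold degS
    have : (SimpleGraph.edge u v).neighborSet w = ∅ := by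
      ext y; simp [edge_adj' h, hu, hv]
    simp [this]
  simp [this, hu, hv]

theorem oddSet_flip [Finite α] (G : SimpleGraph α) {u v : α} (h : u ≠ v) :
    oddSet (G ∆ SimpleGraph.edge u v) = oddSet G ∆ {u, v} := by
  rw [oddSet_symmDiff, oddSet_edge h]

theorem even_ncard_oddSet [Finite α] (G : SimpleGraph α) : Even (oddSet G).ncard := by
  classical
  have := Fintype.ofFinite α
  have h := G.even_card_odd_degree_vertices
  convert h using 1
  rw [← Set.ncard_coe_finset]
  congr 1
  ext v
  simp only [mem_oddSet, Finset.coe_filter, Finset.mem_univ, true_and, Set.mem_ofPred_eq]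
  rw [← SimpleGraph.card_neighborFinset_eq_degree, ← Set.ncard_coe_finset]
  simp [degS]

theorem reachable_induct {G : SimpleGraph α} {P : α → Prop}
    (h : ∀ a b, G.Adj a b → P a → P b) {x y : α} (hr : G.Reachable x y) (hx : P x) : P y := by
  obtain ⟨p⟩ := hr
  induction p with
  | nil => exact hx
  | cons hadj p ih => exact ih (h _ _ hadj hx)

theorem exists_adj_of_reachable {G : SimpleGraph α} {x y : α} (hr : G.Reachable x y) (h : x ≠ y) :
    ∃ z, G.Adj y z := by
  obtain ⟨p⟩ := hr.symm
  cases p with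
  | nil => exact absurd rfl h
  | cons hadj p => exact ⟨_, hadj⟩

/-- The component of `p` contains an even number of vertices of odd degree. -/
theorem even_ncard_odd_component [Finite α] (G : SimpleGraph α) (p : α) :
    Even {w | G.Reachable p w ∧ Odd (degS G w)}.ncard := by
  let H : SimpleGraph α :=
    { Adj := fun x y => G.Adj x y ∧ G.Reachable p x
      symm := ⟨fun x y h => ⟨h.1.symm, h.2.trans h.1.reachable⟩⟩
      loopless := ⟨fun x h => G.loopless.irrefl x h.1⟩ }
  convert even_ncard_oddSet H using 2
  ext w
  simp only [Set.mem_ofPred_eq, mem_oddSet]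
  by_cases hw : G.Reachable p w
  · have : degS H w = degS G w := degS_congr fun y => by simp [H, hw]
    simp [hw, this]
  · have : degS H w = 0 := by
      rw [degS_eq_zero_iff]; intro y; simp [H, hw]
    simp [hw, this]

/-- In a component, an odd vertex comes with another one. -/
theorem exists_odd_reachable [Finite α] {G : SimpleGraph α} {p : α} (hp : Odd (degS G p)) :
    ∃ q, q ≠ p ∧ G.Reachable p q ∧ Odd (degS G q) := by
  by_contra hc
  push Not at hc
  have h := even_ncard_odd_component G p
  have : {w | G.Reachable p w ∧ Odd (degS G w)} = {p} := by
    ext w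
    simp only [Set.mem_ofPred_eq, Set.mem_singleton_iff]
    constructor
    · rintro ⟨h1, h2⟩
      by_contra hw
      exact hc w hw h1 h2
    · rintro rfl; exact ⟨SimpleGraph.Reachable.refl _, hp⟩
  rw [this, Set.ncard_singleton] at h
  exact absurd h (by decide)

theorem mem_support_of_reachable [Finite α] {G : SimpleGraph α} (hd : ∀ v, degS G v ≤ 2) {p q r : α}
    (hp : degS G p ≤ 1) (hq : degS G q ≤ 1) (hpq : p ≠ q) {P : G.Walk p q} (hP : P.IsPath)
    (hr : G.Reachable p r) : r ∈ P.support := by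
  refine reachable_induct (P := fun r => r ∈ P.support) ?_ hr P.start_mem_support
  intro a b hab ha
  have hnil : ¬ P.Nil := fun h => hpq h.eq
  have hsub : P.toSubgraph.neighborSet a ⊆ G.neighborSet a := fun y hy => P.toSubgraph.adj_sub hy
  have hle : (G.neighborSet a).ncard ≤ (P.toSubgraph.neighborSet a).ncard := by
    obtain ⟨i, hi, hil⟩ := SimpleGraph.Walk.mem_support_iff_exists_getVert.1 ha
    by_cases h0 : a = p
    · subst h0
      rw [hP.neighborSet_toSubgraph_startpoint hnil, Set.ncard_singleton]; exact hp
    by_cases h1 : a = q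
    · subst h1
      rw [hP.neighborSet_toSubgraph_endpoint hnil, Set.ncard_singleton]; exact hq
    have hi0 : i ≠ 0 := by rintro rfl; simp at hi; exact h0 hi.symm
    have hi1 : i < P.length := by
      rcases hil.lt_or_eq with h | h
      · exact h
      · subst h; simp at hi; exact absurd hi.symm h1
    have := hP.ncard_neighborSet_toSubgraph_internal_eq_two hi0 hi1
    rw [hi] at this
    rw [this]; exact hd a
  have heq := Set.eq_of_subset_of_ncard_le hsub hle
  have hb : b ∈ P.toSubgraph.neighborSet a := by rw [heq]; exact hab
  exact (P.mem_verts_toSubgraph).1 (P.toSubgraph.edge_vert hb.symm)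

theorem three_leaves [Finite α] {G : SimpleGraph α} (hd : ∀ v, degS G v ≤ 2) {p q r : α}
    (hp : degS G p ≤ 1) (hq : degS G q ≤ 1) (hr : degS G r ≤ 1) (hpq : p ≠ q) (hpr : p ≠ r)
    (hqr : q ≠ r) (h1 : G.Reachable p q) : ¬ G.Reachable p r := by
  classical
  intro h2
  obtain ⟨P, hP⟩ := h1.exists_isPath
  have ha := mem_support_of_reachable hd hp hq hpq hP h2
  obtain ⟨i, hi, hil⟩ := SimpleGraph.Walk.mem_support_iff_exists_getVert.1 ha
  have hi0 : i ≠ 0 := by rintro rfl; simp at hi; exact hpr hi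
  have hi1 : i < P.length := by
    rcases hil.lt_or_eq with h | h
    · exact h
    · subst h; simp at hi; exact absurd hi hqr
  have := hP.ncard_neighborSet_toSubgraph_internal_eq_two hi0 hi1
  rw [hi] at this
  have hsub : P.toSubgraph.neighborSet r ⊆ G.neighborSet r := fun y hy => P.toSubgraph.adj_sub hy
  have := Set.ncard_le_ncard hsub
  unfold degS at hr
  omega

/-- The component of `x` is a cycle. -/
def Cyc (L : SimpleGraph α) (x : α) : Prop := ∀ y, L.Reachable x y → degS L y = 2

/-- Maximum degree at most two and no component is a cycle. -/
def LF (L : SimpleGraph α) : Prop := (∀ v, degS L v ≤ 2) ∧ ∀ x, ¬ Cyc L x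

theorem Cyc.self {L : SimpleGraph α} {x : α} (h : Cyc L x) : degS L x = 2 :=
  h x (SimpleGraph.Reachable.refl x)

theorem Cyc.of_reachable {L : SimpleGraph α} {x y : α} (h : Cyc L x) (hr : L.Reachable x y) :
    Cyc L y := fun z hz => h z (hr.trans hz)

theorem cyc_of_isPolycycle [Finite α] {L : SimpleGraph α} (h : IsPolycycle L) {x : α}
    (hx : degS L x = 2) : Cyc L x := by
  intro y hy
  rcases h y with h0 | h0
  · by_cases hxy : x = y
    · rw [← hxy]; exact hx
    · obtain ⟨z, hz⟩ := exists_adj_of_reachable hy hxy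
      exact absurd hz (degS_eq_zero_iff.1 h0 z)
  · exact h0

theorem lf_bot [Finite α] : LF (⊥ : SimpleGraph α) := by
  have h : ∀ v, degS (⊥ : SimpleGraph α) v = 0 := fun v => degS_eq_zero_iff.2 (by simp)
  refine ⟨fun v => by simp [h], fun x hx => ?_⟩
  have := hx.self
  simp [h] at this

theorem LF.isAcyclic [Finite α] {L : SimpleGraph α} (h : LF L) : L.IsAcyclic := by
  intro v c hc
  have key : ∀ w ∈ c.support, degS L w = 2 ∧ c.toSubgraph.neighborSet w = L.neighborSet w := by
    intro w hw
    have h2 := hc.ncard_neighborSet_toSubgraph_eq_two hw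
    have hsub : c.toSubgraph.neighborSet w ⊆ L.neighborSet w :=
      fun y hy => c.toSubgraph.adj_sub hy
    have hle := Set.ncard_le_ncard hsub
    have := h.1 w
    unfold degS at this ⊢
    exact ⟨by omega, Set.eq_of_subset_of_ncard_le hsub (by omega)⟩
  refine h.2 v fun y hy => (key y ?_).1
  refine reachable_induct (P := fun r => r ∈ c.support) ?_ hy c.start_mem_support
  intro a b hab ha
  have hb : b ∈ c.toSubgraph.neighborSet a := by rw [(key a ha).2]; exact hab
  exact (c.mem_verts_toSubgraph).1 (c.toSubgraph.edge_vert hb.symm)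

theorem LF.exists_odd [Finite α] {L : SimpleGraph α} (h : LF L) {x : α} (hx : 0 < degS L x) :
    ∃ y, L.Reachable x y ∧ Odd (degS L y) := by
  have := h.2 x
  unfold Cyc at this
  push Not at this
  obtain ⟨y, hy, hd⟩ := this
  refine ⟨y, hy, ?_⟩
  have h2 := h.1 y
  have h1 : 0 < degS L y := by
    by_cases hxy : x = y
    · rwa [← hxy]
    · rw [degS_pos_iff]; exact exists_adj_of_reachable hy hxy
  have : degS L y = 1 := by omega
  rw [this]; exact odd_one

theorem LF.isPathGraph [Finite α] {L : SimpleGraph α} (h : LF L) {p q : α} (hpq : p ≠ q)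
    (ho : oddSet L = {p, q}) : IsPathGraph L := by
  have hmem : ∀ z, Odd (degS L z) → z = p ∨ z = q := fun z hz => by
    have : z ∈ oddSet L := hz
    rw [ho] at this; simpa using this
  have hp : Odd (degS L p) := by
    have : p ∈ oddSet L := by rw [ho]; simp
    exact this
  obtain ⟨r, hr1, hr2, hr3⟩ := exists_odd_reachable hp
  have hr : r = q := (hmem r hr3).resolve_left hr1
  subst hr
  have key : ∀ x, 0 < degS L x → L.Reachable p x := by
    intro x hx
    obtain ⟨y, hy, hyo⟩ := h.exists_odd hx
    rcases hmem y hyo with rfl | rfl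
    · exact hy.symm
    · exact hr2.trans hy.symm
  refine ⟨?_, h.isAcyclic, h.1, fun u v hu hv => (key u hu).symm.trans (key v hv)⟩
  rintro rfl
  obtain ⟨y, hy⟩ := degS_pos_iff.1 hp.pos
  simp at hy

theorem LF.eq_bot [Finite α] {L : SimpleGraph α} (h : LF L) (ho : oddSet L = ∅) : L = ⊥ := by
  ext x y
  simp only [SimpleGraph.bot_adj, iff_false]
  intro hxy
  obtain ⟨z, _, hz⟩ := h.exists_odd (degS_pos_iff.2 ⟨y, hxy⟩)
  have : z ∈ oddSet L := hz
  simp [ho] at this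

theorem LF.add_edge [Finite α] {L : SimpleGraph α} (h : LF L) {u v : α} (huv : u ≠ v)
    (hu : degS L u ≤ 1) (hv : degS L v ≤ 1) (hr : ¬ L.Reachable u v) :
    LF (L ∆ SimpleGraph.edge u v) := by
  have hn : ¬ L.Adj u v := fun h' => hr h'.reachable
  have hle := le_flip huv hn
  constructor
  · intro w
    by_cases h1 : w = u
    · subst h1; rw [degS_flip_add huv hn]; omega
    by_cases h2 : w = v
    · subst h2; rw [degS_flip_add' huv hn]; omega
    rw [degS_flip_of_ne huv h1 h2]; exact h.1 w
  · intro x hx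
    have main : ∀ a b, a ≠ b → degS L a + 1 = degS (L ∆ SimpleGraph.edge u v) a →
        ¬ L.Reachable a b → (∀ z, z ≠ a → z ≠ b → degS (L ∆ SimpleGraph.edge u v) z = degS L z) →
        ¬ (L ∆ SimpleGraph.edge u v).Reachable x a := by
      intro a b hab hd hr hz hxa
      have hca := hx.of_reachable hxa
      have h1 := hca.self
      obtain ⟨q, hq1, hq2, hq3⟩ := exists_odd_reachable (G := L) (p := a)
        (by rw [show degS L a = 1 by omega]; exact odd_one)
      have h2 := hca q (hq2.mono hle)
      rw [hz q hq1 (by rintro rfl; exact hr hq2)] at h2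
      rw [h2] at hq3
      exact absurd hq3 (by decide)
    have hxu := main u v huv (degS_flip_add huv hn).symm hr
      (fun z hz1 hz2 => degS_flip_of_ne huv hz1 hz2)
    have hxv := main v u huv.symm (degS_flip_add' huv hn).symm (fun h => hr h.symm)
      (fun z hz1 hz2 => degS_flip_of_ne huv hz2 hz1)
    refine h.2 x fun y hy => ?_
    have hxy := hy.mono hle
    rw [← hx y hxy, degS_flip_of_ne huv]
    · rintro rfl; exact hxu hxy
    · rintro rfl; exact hxv hxy

/-- A cycle component of a subgraph is a cycle component. -/
theorem Cyc.of_le [Finite α] {L L' : SimpleGraph α} (hle : L' ≤ L) (hd : ∀ v, degS L v ≤ 2) {w : α}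
    (hc : Cyc L' w) : Cyc L w ∧ ∀ z, L.Reachable w z → L'.Reachable w z := by
  have key : ∀ z, L.Reachable w z → L'.Reachable w z := by
    intro z hz
    refine reachable_induct (P := fun z => L'.Reachable w z) ?_ hz (SimpleGraph.Reachable.refl w)
    intro a b hab ha
    have h1 := hc a ha
    have hsub : L'.neighborSet a ⊆ L.neighborSet a := fun y hy => hle hy
    have heq := Set.eq_of_subset_of_ncard_le hsub (by
      have := hd a
      unfold degS at this h1
      omega)
    have hb : b ∈ L'.neighborSet a := by rw [heq]; exact hab
    exact ha.trans (SimpleGraph.Adj.reachable hb)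
  refine ⟨fun y hy => ?_, key⟩
  have h1 := hc y (key y hy)
  have h2 := degS_mono hle y
  have := hd y
  omega

theorem LF.of_le [Finite α] {L L' : SimpleGraph α} (hle : L' ≤ L) (h : LF L) : LF L' :=
  ⟨fun v => (degS_mono hle v).trans (h.1 v), fun x hx => h.2 x (Cyc.of_le hle h.1 hx).1⟩

theorem Cyc.of_sub_edge [Finite α] {L : SimpleGraph α} (hd : ∀ v, degS L v ≤ 2) {x y w : α}
    (hxy : L.Adj x y) (hc : Cyc (L ∆ SimpleGraph.edge x y) w) : Cyc L w ∧ ¬ L.Reachable w x := by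
  have h := Cyc.of_le (flip_le hxy) hd hc
  refine ⟨h.1, fun hr => ?_⟩
  have h1 := hc x (h.2 x hr)
  have h2 := degS_flip_sub hxy
  have := hd x
  omega

theorem reachable_of_pendant {L : SimpleGraph α} {p q r s : α} (hp : ∀ y, ¬ L.Adj p y)
    (hpq : p ≠ q) (hr : r ≠ p) (hs : s ≠ p)
    (h : (L ∆ SimpleGraph.edge q p).Reachable r s) : L.Reachable r s := by
  classical
  have := reachable_induct (P := fun x => L.Reachable r (if x = p then q else x)) ?_ h
    (by simp [hr])
  · simpa [hs] using this
  · intro a b hab ha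
    rw [flip_adj hpq.symm] at hab
    by_cases h1 : a = p
    · subst h1
      have hb : b = q := by
        by_contra hb
        exact hp b (hab.2 (by rintro (⟨h1, _⟩ | ⟨_, h1⟩); exacts [hpq h1, hb h1]))
      subst hb
      simpa [hpq.symm] using ha
    · by_cases h2 : b = p
      · subst h2
        have haq : a = q := by
          by_contra hb
          exact hp a (hab.2 (by rintro (⟨h1, _⟩ | ⟨h2, _⟩); exacts [hb h1, h1 h2])).symm
        subst haq
        simpa [h1] using ha
      · simp only [h1, h2, if_false] at ha ⊢
        exact ha.trans (SimpleGraph.Adj.reachable (hab.2 (by tauto)))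

/-- `G` has a path odd-cover with at most `n` members. -/
def Cov (n : ℕ) (G : SimpleGraph α) : Prop :=
  ∃ L : List (SimpleGraph α), L.length ≤ n ∧ (∀ P ∈ L, IsPathGraph P) ∧ listSymmDiff L = G

theorem Cov.mono {m n : ℕ} {G : SimpleGraph α} (h : Cov m G) (hmn : m ≤ n) : Cov n G := by
  obtain ⟨L, h1, h2⟩ := h
  exact ⟨L, h1.trans hmn, h2⟩

theorem cov_bot (n : ℕ) : Cov n (⊥ : SimpleGraph α) := ⟨[], by simp, by simp, rfl⟩

theorem listSymmDiff_append (L M : List (SimpleGraph α)) :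
    listSymmDiff (L ++ M) = listSymmDiff L ∆ listSymmDiff M := by
  induction L with
  | nil => simp [listSymmDiff]
  | cons a L ih =>
    have h : ∀ (b : SimpleGraph α) K, listSymmDiff (b :: K) = b ∆ listSymmDiff K := fun _ _ => rfl
    rw [List.cons_append, h, h, ih, symmDiff_assoc]

theorem Cov.add {m n : ℕ} {G H : SimpleGraph α} (h1 : Cov m G) (h2 : Cov n H) :
    Cov (m + n) (G ∆ H) := by
  obtain ⟨L, hL1, hL2, rfl⟩ := h1
  obtain ⟨M, hM1, hM2, rfl⟩ := h2
  refine ⟨L ++ M, by simp; omega, ?_, listSymmDiff_append L M⟩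
  intro P hP
  rcases List.mem_append.1 hP with h | h
  exacts [hL2 P h, hM2 P h]

theorem cov_of_isPathGraph {G : SimpleGraph α} (h : IsPathGraph G) : Cov 1 G :=
  ⟨[G], by simp, by simpa using h, by simp [listSymmDiff]⟩

theorem LF.mem_oddSet {L : SimpleGraph α} (h : LF L) {v : α} : v ∈ oddSet L ↔ degS L v = 1 := by
  rw [PathOddCover.mem_oddSet]
  have := h.1 v
  constructor
  · intro ho
    obtain ⟨k, hk⟩ := ho
    omega
  · intro h1; rw [h1]; exact odd_one

theorem LF.cov [Finite α] {L : SimpleGraph α} (h : LF L) (hc : (oddSet L).ncard ≤ 2) : Cov 1 L := by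
  have he := even_ncard_oddSet L
  have : (oddSet L).ncard = 0 ∨ (oddSet L).ncard = 2 := by
    obtain ⟨k, hk⟩ := he
    omega
  rcases this with h0 | h2
  · rw [Set.ncard_eq_zero] at h0
    rw [h.eq_bot h0]; exact cov_bot 1
  · obtain ⟨p, q, hpq, ho⟩ := Set.ncard_eq_two.1 h2
    exact cov_of_isPathGraph (h.isPathGraph hpq ho)

theorem LF.cov_pair [Finite α] {L : SimpleGraph α} (h : LF L) {p q : α} (ho : oddSet L = {p, q}) :
    Cov 1 L :=
  h.cov (by rw [ho]; exact (Set.ncard_insert_le _ _).trans (by simp))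

theorem cov_edge [Finite α] {u v : α} (h : u ≠ v) : Cov 1 (SimpleGraph.edge u v) := by
  have h1 := (lf_bot (α := α)).add_edge h
    (by rw [degS_eq_zero_iff.2] <;> simp) (by rw [degS_eq_zero_iff.2] <;> simp)
    (by
      intro hr
      obtain ⟨z, hz⟩ := exists_adj_of_reachable hr h
      simp at hz)
  rw [bot_symmDiff] at h1
  exact h1.cov_pair (oddSet_edge h)

theorem flip_symmDiff_flip (L M : SimpleGraph α) (u v : α) :
    (L ∆ SimpleGraph.edge u v) ∆ (M ∆ SimpleGraph.edge u v) = L ∆ M := by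
  rw [symmDiff_symmDiff_symmDiff_comm, symmDiff_self, symmDiff_bot]

/-- Among three leaves of a linear forest, at most one pair is joined. -/
theorem LF.leaf_pairs [Finite α] {L : SimpleGraph α} (h : LF L) {p q r : α} (hp : p ∈ oddSet L)
    (hq : q ∈ oddSet L) (hr : r ∈ oddSet L) (hpq : p ≠ q) (hpr : p ≠ r) (hqr : q ≠ r) :
    ¬ (L.Reachable p q ∧ L.Reachable p r) ∧ ¬ (L.Reachable p q ∧ L.Reachable q r) ∧
      ¬ (L.Reachable p r ∧ L.Reachable q r) := by
  have hp := (h.mem_oddSet.1 hp).le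
  have hq := (h.mem_oddSet.1 hq).le
  have hr := (h.mem_oddSet.1 hr).le
  have h1 := three_leaves h.1 hp hq hr hpq hpr hqr
  exact ⟨fun h' => h1 h'.1 h'.2, fun h' => h1 h'.1 (h'.1.trans h'.2),
    fun h' => h1 (h'.1.trans h'.2.symm) h'.1⟩

theorem symmDiff_inter_symmDiff {S T P : Set α} (h : P ⊆ S ∩ T) :
    (S ∆ P) ∩ (T ∆ P) = (S ∩ T) \ P := by
  ext w
  have := @h w
  simp only [Set.mem_inter_iff, Set.mem_symmDiff, Set.mem_sdiff] at *
  tauto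

theorem symmDiff_sdiff_symmDiff {S T P : Set α} (h : P ⊆ S ∩ T) :
    (S ∆ P) \ (T ∆ P) = S \ T := by
  ext w
  have := @h w
  simp only [Set.mem_inter_iff, Set.mem_symmDiff, Set.mem_sdiff] at *
  tauto

/-- Joining common leaves of two linear forests until at most two are left. -/
theorem reduce_two [Finite α] (n : ℕ) : ∀ (L₁ L₂ : SimpleGraph α), LF L₁ → LF L₂ →
    (oddSet L₁ ∩ oddSet L₂).ncard ≤ n →
    ∃ M₁ M₂ : SimpleGraph α, LF M₁ ∧ LF M₂ ∧ M₁ ∆ M₂ = L₁ ∆ L₂ ∧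
      oddSet M₁ \ oddSet M₂ = oddSet L₁ \ oddSet L₂ ∧
      oddSet M₂ \ oddSet M₁ = oddSet L₂ \ oddSet L₁ ∧
      (oddSet M₁ ∩ oddSet M₂).ncard ≤ 2 ∧ oddSet M₁ ∩ oddSet M₂ ⊆ oddSet L₁ ∩ oddSet L₂ ∧
      ∀ w, w ∉ oddSet L₁ ∩ oddSet L₂ → degS M₁ w = degS L₁ w ∧ degS M₂ w = degS L₂ w := by
  induction n with
  | zero =>
    intro L₁ L₂ h1 h2 hc
    exact ⟨L₁, L₂, h1, h2, rfl, rfl, rfl, by omega, subset_rfl, fun _ _ => ⟨rfl, rfl⟩⟩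
  | succ n ih =>
    intro L₁ L₂ h1 h2 hc
    by_cases hc2 : (oddSet L₁ ∩ oddSet L₂).ncard ≤ 2
    · exact ⟨L₁, L₂, h1, h2, rfl, rfl, rfl, hc2, subset_rfl, fun _ _ => ⟨rfl, rfl⟩⟩
    rw [not_le, Set.two_lt_ncard] at hc2
    obtain ⟨p, ⟨hp1, hp2⟩, q, ⟨hq1, hq2⟩, r, ⟨hr1, hr2⟩, hpq, hpr, hqr⟩ := hc2
    have a1 := h1.leaf_pairs hp1 hq1 hr1 hpq hpr hqr
    have a2 := h2.leaf_pairs hp2 hq2 hr2 hpq hpr hqr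
    have : ∃ u v, u ≠ v ∧ u ∈ oddSet L₁ ∩ oddSet L₂ ∧ v ∈ oddSet L₁ ∩ oddSet L₂ ∧
        ¬ L₁.Reachable u v ∧ ¬ L₂.Reachable u v := by
      by_cases b1 : L₁.Reachable p q ∨ L₂.Reachable p q
      · by_cases b2 : L₁.Reachable p r ∨ L₂.Reachable p r
        · exact ⟨q, r, hqr, ⟨hq1, hq2⟩, ⟨hr1, hr2⟩, by tauto, by tauto⟩
        · exact ⟨p, r, hpr, ⟨hp1, hp2⟩, ⟨hr1, hr2⟩, by tauto, by tauto⟩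
      · exact ⟨p, q, hpq, ⟨hp1, hp2⟩, ⟨hq1, hq2⟩, by tauto, by tauto⟩
    obtain ⟨u, v, huv, hu, hv, n1, n2⟩ := this
    have k1 := h1.add_edge huv (h1.mem_oddSet.1 hu.1).le (h1.mem_oddSet.1 hv.1).le n1
    have k2 := h2.add_edge huv (h2.mem_oddSet.1 hu.2).le (h2.mem_oddSet.1 hv.2).le n2
    have o1 := oddSet_flip L₁ huv
    have o2 := oddSet_flip L₂ huv
    have hP : ({u, v} : Set α) ⊆ oddSet L₁ ∩ oddSet L₂ := by
      rintro w (rfl | rfl)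
      exacts [hu, hv]
    have hI : oddSet (L₁ ∆ SimpleGraph.edge u v) ∩ oddSet (L₂ ∆ SimpleGraph.edge u v) =
        (oddSet L₁ ∩ oddSet L₂) \ {u, v} := by
      rw [o1, o2, symmDiff_inter_symmDiff hP]
    have hlt : ((oddSet L₁ ∩ oddSet L₂) \ {u, v}).ncard < (oddSet L₁ ∩ oddSet L₂).ncard :=
      Set.ncard_lt_ncard ⟨Set.sdiff_subset, fun h => (h hu).2 (by simp)⟩
    obtain ⟨M₁, M₂, m1, m2, m3, m4, m5, m6, m7, m8⟩ :=
      ih _ _ k1 k2 (by rw [hI]; omega)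
    have hd : ∀ w, w ∉ oddSet L₁ ∩ oddSet L₂ → w ≠ u ∧ w ≠ v := fun w hw =>
      ⟨by rintro rfl; exact hw hu, by rintro rfl; exact hw hv⟩
    refine ⟨M₁, M₂, m1, m2, by rw [m3, flip_symmDiff_flip], ?_, ?_, m6, ?_, ?_⟩
    · rw [m4, o1, o2, symmDiff_sdiff_symmDiff hP]
    · rw [m5, o1, o2, symmDiff_sdiff_symmDiff (by rwa [Set.inter_comm])]
    · rw [hI] at m7; exact m7.trans Set.sdiff_subset
    · intro w hw
      obtain ⟨e1, e2⟩ := hd w hw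
      have := m8 w (by rw [hI]; exact fun h => hw h.1)
      rw [degS_flip_of_ne huv e1 e2, degS_flip_of_ne huv e1 e2] at this
      exact this

theorem ncard_diff_parity [Finite α] {L : SimpleGraph α} (s : Set α) :
    Even ((oddSet L \ s).ncard + (oddSet L ∩ s).ncard) := by
  rw [add_comm, Set.ncard_inter_add_ncard_sdiff_eq_ncard]
  exact even_ncard_oddSet L

/-- Two linear forests with an odd number of common leaves can be changed to have just one. -/
theorem reduce_one [Finite α] {L₁ L₂ : SimpleGraph α} (h1 : LF L₁) (h2 : LF L₂)
    (ho : Odd (oddSet L₁ ∩ oddSet L₂).ncard) :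
    ∃ M₁ M₂ : SimpleGraph α, LF M₁ ∧ LF M₂ ∧ M₁ ∆ M₂ = L₁ ∆ L₂ ∧
      oddSet M₁ \ oddSet M₂ = oddSet L₁ \ oddSet L₂ ∧
      oddSet M₂ \ oddSet M₁ = oddSet L₂ \ oddSet L₁ ∧
      ∃ p, oddSet M₁ ∩ oddSet M₂ = {p} := by
  obtain ⟨M₁, M₂, m1, m2, m3, m4, m5, m6, -, -⟩ := reduce_two _ L₁ L₂ h1 h2 le_rfl
  refine ⟨M₁, M₂, m1, m2, m3, m4, m5, Set.ncard_eq_one.1 ?_⟩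
  have e1 := ncard_diff_parity (L := L₁) (oddSet L₂)
  have e2 := ncard_diff_parity (L := M₁) (oddSet M₂)
  rw [m4] at e2
  rw [Nat.even_iff] at e1 e2
  rw [Nat.odd_iff] at ho
  omega

theorem three_forests [Finite α] {L₁ L₂ L₃ : SimpleGraph α} (h1 : LF L₁) (h2 : LF L₂) (h3 : LF L₃)
    (hs : oddSet L₃ = oddSet L₁ ∆ oddSet L₂) (ho : Odd (oddSet L₁ ∩ oddSet L₂).ncard) :
    Cov 3 (L₁ ∆ L₂ ∆ L₃) := by
  obtain ⟨A₁, A₂, a1, a2, a3, a4, a5, p, hp⟩ := reduce_one h1 h2 ho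
  have hsA : oddSet L₃ = oddSet A₁ ∆ oddSet A₂ := by
    rw [hs, ← oddSet_symmDiff, ← oddSet_symmDiff, a3]
  have i1 : oddSet A₁ ∩ oddSet L₃ = oddSet A₁ \ oddSet A₂ := by
    rw [hsA]; ext w; simp only [Set.mem_inter_iff, Set.mem_symmDiff, Set.mem_sdiff]; tauto
  have i2 : oddSet A₁ \ oddSet L₃ = {p} := by
    rw [← hp, hsA]; ext w; simp only [Set.mem_inter_iff, Set.mem_symmDiff, Set.mem_sdiff]; tauto
  have e1 := ncard_diff_parity (L := A₁) (oddSet A₂)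
  rw [hp, Set.ncard_singleton] at e1
  obtain ⟨B₁, B₃, b1, b3, b4, b5, -, q, hq⟩ := reduce_one a1 h3 (by
    rw [i1]; rw [Nat.even_iff] at e1; rw [Nat.odd_iff]; omega)
  rw [i2] at b5
  have hsB : oddSet A₂ = oddSet B₁ ∆ oddSet B₃ := by
    rw [← oddSet_symmDiff, b4, oddSet_symmDiff, hsA, symmDiff_symmDiff_cancel_left]
  have i3 : oddSet A₂ ∩ oddSet B₃ = oddSet B₃ \ oddSet B₁ := by
    rw [hsB]; ext w; simp only [Set.mem_inter_iff, Set.mem_symmDiff, Set.mem_sdiff]; tauto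
  have i4 : oddSet A₂ \ oddSet B₃ = {p} := by
    rw [← b5, hsB]; ext w; simp only [Set.mem_symmDiff, Set.mem_sdiff]; tauto
  have i5 : oddSet B₃ \ oddSet A₂ = {q} := by
    rw [← hq, hsB]; ext w; simp only [Set.mem_inter_iff, Set.mem_symmDiff, Set.mem_sdiff]; tauto
  have e2 := ncard_diff_parity (L := B₃) (oddSet B₁)
  rw [Set.inter_comm, hq, Set.ncard_singleton] at e2
  obtain ⟨C₂, C₃, c2, c3, c4, c5, c6, r, hr⟩ := reduce_one a2 b3 (by
    rw [i3]; rw [Nat.even_iff] at e2; rw [Nat.odd_iff]; omega)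
  rw [i4] at c5
  rw [i5] at c6
  have o1 : oddSet B₁ = {p, q} := by
    rw [Set.insert_eq, ← b5, ← hq, Set.sdiff_union_inter]
  have o2 : oddSet C₂ = {p, r} := by
    rw [Set.insert_eq, ← c5, ← hr, Set.sdiff_union_inter]
  have o3 : oddSet C₃ = {q, r} := by
    rw [Set.insert_eq, ← c6, ← hr, Set.inter_comm, Set.sdiff_union_inter]
  have hsum : L₁ ∆ L₂ ∆ L₃ = B₁ ∆ (C₂ ∆ C₃) := by
    rw [c4, ← a3, symmDiff_left_comm, b4, symmDiff_left_comm, symmDiff_assoc]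
  rw [hsum]
  exact (b1.cov_pair o1).add ((c2.cov_pair o2).add (c3.cov_pair o3))

/-- Two graphs of maximum degree two together with a linear forest that absorbs edges of their
cycles. -/
structure Absorb (L₁ L₂ L₃ : SimpleGraph α) : Prop where
  d₁ : ∀ v, degS L₁ v ≤ 2
  d₂ : ∀ v, degS L₂ v ≤ 2
  sum : ∀ v, degS L₁ v + degS L₂ v + degS L₃ v ≤ 4
  lf : LF L₃
  c₁ : ∀ v, Cyc L₁ v → degS L₃ v ≤ 1
  c₂ : ∀ v, Cyc L₂ v → degS L₃ v ≤ 1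

theorem Absorb.swap {L₁ L₂ L₃ : SimpleGraph α} (h : Absorb L₁ L₂ L₃) : Absorb L₂ L₁ L₃ :=
  ⟨h.d₂, h.d₁, fun v => by have := h.sum v; omega, h.lf, h.c₂, h.c₁⟩

theorem Absorb.move [Finite α] {L₁ L₂ L₃ : SimpleGraph α} (h : Absorb L₁ L₂ L₃) {x y : α}
    (hx : Cyc L₁ x) (hxy : L₁.Adj x y) (hr : ¬ L₃.Reachable x y) :
    Absorb (L₁ ∆ SimpleGraph.edge x y) L₂ (L₃ ∆ SimpleGraph.edge x y) := by
  have hne := hxy.ne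
  have hy : Cyc L₁ y := hx.of_reachable hxy.reachable
  have hn3 : ¬ L₃.Adj x y := fun h' => hr h'.reachable
  have a1 := degS_flip_sub hxy
  have a2 := degS_flip_sub' hxy
  have a3 := degS_flip_add hne hn3
  have a4 := degS_flip_add' hne hn3
  have b1 := fun w h1 h2 => degS_flip_of_ne (G := L₁) (w := w) hne h1 h2
  have b3 := fun w h1 h2 => degS_flip_of_ne (G := L₃) (w := w) hne h1 h2
  refine ⟨fun v => (degS_mono (flip_le hxy) v).trans (h.d₁ v), h.d₂, fun v => ?_,
    h.lf.add_edge hne (h.c₁ x hx) (h.c₁ y hy) hr, fun v hv => ?_, fun v hv => ?_⟩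
  · have := h.sum v
    by_cases h1 : v = x
    · subst h1; omega
    by_cases h2 : v = y
    · subst h2; omega
    rw [b1 v h1 h2, b3 v h1 h2]; exact this
  · obtain ⟨h1, h2⟩ := hv.of_sub_edge h.d₁ hxy
    have hvx : v ≠ x := by rintro rfl; exact h2 (SimpleGraph.Reachable.refl _)
    have hvy : v ≠ y := by rintro rfl; exact h2 hxy.symm.reachable
    rw [b3 v hvx hvy]; exact h.c₁ v h1
  · have := h.sum v
    have := hv.self
    by_cases h1 : v = x
    · subst h1; have := hx.self; omega
    by_cases h2 : v = y
    · subst h2; have := hy.self; omega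
    rw [b3 v h1 h2]; exact h.c₂ v hv

theorem Absorb.exists_move [Finite α] {L₁ L₂ L₃ : SimpleGraph α} (h : Absorb L₁ L₂ L₃) {x : α}
    (hx : Cyc L₁ x) : ∃ y, L₁.Adj x y ∧ ¬ L₃.Reachable x y := by
  obtain ⟨a, b, hab, hn⟩ := degS_eq_two_iff.1 hx.self
  have ha : L₁.Adj x a := (hn a).2 (Or.inl rfl)
  have hb : L₁.Adj x b := (hn b).2 (Or.inr rfl)
  by_cases hr : L₃.Reachable x a
  · exact ⟨b, hb, three_leaves h.lf.1 (h.c₁ x hx) (h.c₁ a (hx.of_reachable ha.reachable))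
      (h.c₁ b (hx.of_reachable hb.reachable)) ha.ne hb.ne hab hr⟩
  · exact ⟨a, ha, hr⟩

/-- `M₁, M₂, M₃` arises from `L₁, L₂, L₃` by moving edges of cycles until all remaining cycles
meet `S`. -/
structure Cut (S : Set α) (L₁ L₂ L₃ M₁ M₂ M₃ : SimpleGraph α) : Prop where
  absorb : Absorb M₁ M₂ M₃
  le₁ : M₁ ≤ L₁
  le₂ : M₂ ≤ L₂
  sum_eq : M₁ ∆ M₂ ∆ M₃ = L₁ ∆ L₂ ∆ L₃
  cyc₁ : ∀ w, Cyc M₁ w → ∃ v ∈ S, L₁.Reachable w v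
  cyc₂ : ∀ w, Cyc M₂ w → ∃ v ∈ S, L₂.Reachable w v
  adj₁ : ∀ w, (Cyc L₁ w → ∃ v ∈ S, L₁.Reachable w v) → ∀ y, M₁.Adj w y ↔ L₁.Adj w y
  adj₂ : ∀ w, (Cyc L₂ w → ∃ v ∈ S, L₂.Reachable w v) → ∀ y, M₂.Adj w y ↔ L₂.Adj w y
  adj₃ : ∀ w, (Cyc L₁ w → ∃ v ∈ S, L₁.Reachable w v) →
    (Cyc L₂ w → ∃ v ∈ S, L₂.Reachable w v) → ∀ y, M₃.Adj w y ↔ L₃.Adj w y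

theorem Cut.swap {S : Set α} {L₁ L₂ L₃ M₁ M₂ M₃ : SimpleGraph α} (h : Cut S L₁ L₂ L₃ M₁ M₂ M₃) :
    Cut S L₂ L₁ L₃ M₂ M₁ M₃ :=
  ⟨h.absorb.swap, h.le₂, h.le₁, by rw [symmDiff_comm M₂, symmDiff_comm L₂]; exact h.sum_eq,
    h.cyc₂, h.cyc₁, h.adj₂, h.adj₁, fun w h1 h2 => h.adj₃ w h2 h1⟩

theorem Cut.of_move [Finite α] {S : Set α} {L₁ L₂ L₃ M₁ M₂ M₃ : SimpleGraph α} {x y : α}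
    (hd : ∀ v, degS L₁ v ≤ 2)
    (hx : Cyc L₁ x) (hS : ¬ ∃ v ∈ S, L₁.Reachable x v) (hxy : L₁.Adj x y)
    (h : Cut S (L₁ ∆ SimpleGraph.edge x y) L₂ (L₃ ∆ SimpleGraph.edge x y) M₁ M₂ M₃) :
    Cut S L₁ L₂ L₃ M₁ M₂ M₃ := by
  have hle := flip_le hxy
  have hne : ∀ w, (Cyc L₁ w → ∃ v ∈ S, L₁.Reachable w v) → w ≠ x ∧ w ≠ y := by
    intro w hw
    constructor
    · rintro rfl; exact hS (hw hx)
    · rintro rfl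
      obtain ⟨v, hv, hr⟩ := hw (hx.of_reachable hxy.reachable)
      exact hS ⟨v, hv, hxy.reachable.trans hr⟩
  have hcond : ∀ w, (Cyc L₁ w → ∃ v ∈ S, L₁.Reachable w v) →
      Cyc (L₁ ∆ SimpleGraph.edge x y) w → ∃ v ∈ S, (L₁ ∆ SimpleGraph.edge x y).Reachable w v := by
    intro w hw hc
    obtain ⟨h1, h2⟩ := hc.of_le hle hd
    obtain ⟨v, hv, hr⟩ := hw h1
    exact ⟨v, hv, h2 v hr⟩
  refine ⟨h.absorb, h.le₁.trans hle, h.le₂, ?_, ?_, h.cyc₂, ?_, h.adj₂, ?_⟩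
  · rw [h.sum_eq, symmDiff_right_comm L₁, flip_symmDiff_flip, symmDiff_right_comm]
  · intro w hw
    obtain ⟨v, hv, hr⟩ := h.cyc₁ w hw
    exact ⟨v, hv, hr.mono hle⟩
  · intro w hw z
    rw [h.adj₁ w (hcond w hw), flip_adj_of_ne hxy.ne (hne w hw).1 (hne w hw).2]
  · intro w hw hw2 z
    rw [h.adj₃ w (hcond w hw) hw2, flip_adj_of_ne hxy.ne (hne w hw).1 (hne w hw).2]

theorem ncard_edgeSet_flip_lt [Finite α] {L : SimpleGraph α} {x y : α} (h : L.Adj x y) :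
    (L ∆ SimpleGraph.edge x y).edgeSet.ncard < L.edgeSet.ncard := by
  refine Set.ncard_lt_ncard (SimpleGraph.edgeSet_ssubset_edgeSet.2 (lt_of_le_of_ne (flip_le h) ?_))
  intro he
  have : (L ∆ SimpleGraph.edge x y).Adj x y := by rw [he]; exact h
  rw [flip_adj h.ne] at this
  simp [h] at this

theorem exists_cut [Finite α] (S : Set α) (n : ℕ) : ∀ L₁ L₂ L₃ : SimpleGraph α,
    L₁.edgeSet.ncard + L₂.edgeSet.ncard ≤ n → Absorb L₁ L₂ L₃ →
    ∃ M₁ M₂ M₃, Cut S L₁ L₂ L₃ M₁ M₂ M₃ := by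
  induction n with
  | zero =>
    intro L₁ L₂ L₃ hn h
    have hno : ∀ {L : SimpleGraph α}, L.edgeSet.ncard = 0 → ∀ w, ¬ Cyc L w := by
      intro L hL w hw
      rw [Set.ncard_eq_zero] at hL
      obtain ⟨y, hy⟩ := degS_pos_iff.1 (by rw [hw.self]; norm_num : 0 < degS L w)
      have : s(w, y) ∈ L.edgeSet := hy
      simp [hL] at this
    exact ⟨L₁, L₂, L₃, h, le_rfl, le_rfl, rfl, fun w hw => (hno (by omega) w hw).elim,
      fun w hw => (hno (by omega) w hw).elim, fun _ _ _ => Iff.rfl, fun _ _ _ => Iff.rfl,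
      fun _ _ _ _ => Iff.rfl⟩
  | succ n ih =>
    intro L₁ L₂ L₃ hn h
    by_cases h1 : ∃ x, Cyc L₁ x ∧ ¬ ∃ v ∈ S, L₁.Reachable x v
    · obtain ⟨x, hx, hS⟩ := h1
      obtain ⟨y, hxy, hr⟩ := h.exists_move hx
      have := ncard_edgeSet_flip_lt hxy
      obtain ⟨M₁, M₂, M₃, hM⟩ := ih _ _ _ (by omega) (h.move hx hxy hr)
      exact ⟨M₁, M₂, M₃, hM.of_move h.d₁ hx hS hxy⟩
    by_cases h2 : ∃ x, Cyc L₂ x ∧ ¬ ∃ v ∈ S, L₂.Reachable x v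
    · obtain ⟨x, hx, hS⟩ := h2
      obtain ⟨y, hxy, hr⟩ := h.swap.exists_move hx
      have := ncard_edgeSet_flip_lt hxy
      obtain ⟨M₁, M₂, M₃, hM⟩ := ih _ _ _ (by omega) (h.swap.move hx hxy hr)
      exact ⟨M₂, M₁, M₃, (hM.of_move h.d₂ hx hS hxy).swap⟩
    push Not at h1 h2
    exact ⟨L₁, L₂, L₃, h, le_rfl, le_rfl, rfl, h1, h2, fun _ _ _ => Iff.rfl, fun _ _ _ => Iff.rfl,
      fun _ _ _ _ => Iff.rfl⟩

theorem Absorb.exists_cut [Finite α] {L₁ L₂ L₃ : SimpleGraph α} (h : Absorb L₁ L₂ L₃) (S : Set α) :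
    ∃ M₁ M₂ M₃, Cut S L₁ L₂ L₃ M₁ M₂ M₃ :=
  PathOddCover.exists_cut S _ L₁ L₂ L₃ le_rfl h

theorem ncard_le_two_of_subset {s : Set α} {x y : α} (h : s ⊆ {x, y}) : s.ncard ≤ 2 :=
  (Set.ncard_le_ncard h (Set.toFinite _)).trans ((Set.ncard_insert_le _ _).trans (by simp))

theorem not_reachable_of_isolated [Finite α] {L : SimpleGraph α} {u v : α} (h : u ≠ v)
    (h0 : degS L u = 0) : ¬ L.Reachable u v := by
  intro hr
  obtain ⟨z, hz⟩ := exists_adj_of_reachable hr.symm h.symm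
  exact degS_eq_zero_iff.1 h0 z hz

theorem LF.cov_join [Finite α] {M₁ M₂ : SimpleGraph α} (h1 : LF M₁) (h2 : LF M₂) {u v : α}
    (huv : u ≠ v) (du₁ : degS M₁ u ≤ 1) (du₂ : degS M₂ u ≤ 1) (dv₁ : degS M₁ v ≤ 1)
    (dv₂ : degS M₂ v ≤ 1) (r₁ : ¬ M₁.Reachable u v) (r₂ : ¬ M₂.Reachable u v)
    {x₁ y₁ x₂ y₂ : α} (o₁ : oddSet M₁ ∆ {u, v} ⊆ {x₁, y₁}) (o₂ : oddSet M₂ ∆ {u, v} ⊆ {x₂, y₂}) :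
    Cov 2 (M₁ ∆ M₂) := by
  rw [← flip_symmDiff_flip M₁ M₂ u v]
  exact ((h1.add_edge huv du₁ dv₁ r₁).cov (by
      rw [oddSet_flip _ huv]; exact ncard_le_two_of_subset o₁)).add
    ((h2.add_edge huv du₂ dv₂ r₂).cov (by
      rw [oddSet_flip _ huv]; exact ncard_le_two_of_subset o₂))

theorem LF.deg_le_one [Finite α] {L : SimpleGraph α} (h : LF L) {v : α} (hv : v ∈ oddSet L) :
    degS L v ≤ 1 := (h.mem_oddSet.1 hv).le

theorem cov_two_of_oddSet_eq [Finite α] {L₁ L₂ : SimpleGraph α} (h1 : LF L₁) (h2 : LF L₂)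
    (ho : oddSet L₁ = oddSet L₂) : Cov 2 (L₁ ∆ L₂) := by
  obtain ⟨M₁, M₂, m1, m2, m3, m4, m5, m6, -, -⟩ := reduce_two _ L₁ L₂ h1 h2 le_rfl
  rw [ho, sdiff_self] at m4 m5
  have e1 : oddSet M₁ ∩ oddSet M₂ = oddSet M₁ :=
    Set.inter_eq_left.2 (Set.sdiff_eq_empty.1 m4)
  have e2 : oddSet M₁ ∩ oddSet M₂ = oddSet M₂ :=
    Set.inter_eq_right.2 (Set.sdiff_eq_empty.1 m5)
  rw [← m3]
  exact (m1.cov (by rwa [← e1])).add (m2.cov (by rwa [← e2]))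

theorem cov_two_of_pair [Finite α] {L₁ L₂ : SimpleGraph α} (h1 : LF L₁) (h2 : LF L₂) {a b : α}
    (o1 : oddSet L₁ \ oddSet L₂ = {a, b}) (o2 : oddSet L₂ \ oddSet L₁ = ∅)
    (ha : degS L₂ a = 0) : Cov 2 (L₁ ∆ L₂) := by
  obtain ⟨M₁, M₂, m1, m2, m3, m4, m5, m6, -, m8⟩ := reduce_two _ L₁ L₂ h1 h2 le_rfl
  rw [o1] at m4
  rw [o2] at m5
  have am : a ∈ oddSet L₁ \ oddSet L₂ := by rw [o1]; simp
  have ha2 : degS M₂ a = 0 := by rw [(m8 a (fun h => am.2 h.2)).2, ha]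
  rw [← m3]
  have e2 := ncard_diff_parity (L := M₂) (oddSet M₁)
  rw [m5, Set.ncard_empty, Set.inter_comm, Nat.even_iff] at e2
  have : (oddSet M₁ ∩ oddSet M₂).ncard = 0 ∨ (oddSet M₁ ∩ oddSet M₂).ncard = 2 := by omega
  have hs1 := Set.ext_iff.1 m4
  have hs2 := Set.ext_iff.1 m5
  simp only [Set.mem_sdiff, Set.mem_insert_iff, Set.mem_singleton_iff, Set.mem_empty_iff_false]
    at hs1 hs2
  rcases this with h0 | hu
  · rw [Set.ncard_eq_zero] at h0
    have h0 := Set.ext_iff.1 h0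
    simp only [Set.mem_inter_iff, Set.mem_empty_iff_false] at h0
    refine (m1.cov (ncard_le_two_of_subset (x := a) (y := b) ?_)).add
      (m2.cov (ncard_le_two_of_subset (x := a) (y := b) ?_)) <;> intro w hw <;> grind
  · obtain ⟨u, u', huu, hU⟩ := Set.ncard_eq_two.1 hu
    have hs3 := Set.ext_iff.1 hU
    simp only [Set.mem_inter_iff, Set.mem_insert_iff, Set.mem_singleton_iff] at hs3
    have key : ∀ u u', u ≠ u' → (∀ x, x ∈ oddSet M₁ ∧ x ∈ oddSet M₂ ↔ x = u ∨ x = u') →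
        ¬ M₁.Reachable a u → Cov 2 (M₁ ∆ M₂) := by
      intro u u' huu hs3 hr
      have hau : a ≠ u := by grind
      have am1 : a ∈ oddSet M₁ := by grind
      have um1 : u ∈ oddSet M₁ := by grind
      have um2 : u ∈ oddSet M₂ := by grind
      refine m1.cov_join m2 hau (m1.deg_le_one am1) (by omega) (m1.deg_le_one um1)
        (m2.deg_le_one um2) hr (not_reachable_of_isolated hau ha2) (x₁ := b) (y₁ := u')
        (x₂ := a) (y₂ := u') ?_ ?_ <;> intro w hw <;>
        simp only [Set.mem_symmDiff, Set.mem_insert_iff, Set.mem_singleton_iff] at hw ⊢ <;> grind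
    have am1 : a ∈ oddSet M₁ := by grind
    have := m1.leaf_pairs (p := a) (q := u) (r := u') am1 (by grind) (by grind) (by grind)
      (by grind) huu
    by_cases hr : M₁.Reachable a u
    · exact key u' u huu.symm (fun x => by rw [hs3 x, or_comm]) (by tauto)
    · exact key u u' huu hs3 hr

theorem cov_two_of_three_one [Finite α] {L₁ L₂ : SimpleGraph α} (h1 : LF L₁) (h2 : LF L₂)
    {a b c d : α} (hab : a ≠ b) (hac : a ≠ c) (hbc : b ≠ c)
    (o1 : oddSet L₁ \ oddSet L₂ = {a, b, c}) (o2 : oddSet L₂ \ oddSet L₁ = {d})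
    (ha : degS L₂ a = 0) (hb : degS L₂ b = 0) : Cov 2 (L₁ ∆ L₂) := by
  obtain ⟨M₁, M₂, m1, m2, m3, m4, m5, m6, -, m8⟩ := reduce_two _ L₁ L₂ h1 h2 le_rfl
  rw [o1] at m4
  rw [o2] at m5
  have am : a ∈ oddSet L₁ \ oddSet L₂ := by rw [o1]; simp
  have bm : b ∈ oddSet L₁ \ oddSet L₂ := by rw [o1]; simp
  have ha2 : degS M₂ a = 0 := by rw [(m8 a (fun h => am.2 h.2)).2, ha]
  have hb2 : degS M₂ b = 0 := by rw [(m8 b (fun h => bm.2 h.2)).2, hb]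
  rw [← m3]
  have e2 := ncard_diff_parity (L := M₂) (oddSet M₁)
  rw [m5, Set.ncard_singleton, Set.inter_comm, Nat.even_iff] at e2
  have : (oddSet M₁ ∩ oddSet M₂).ncard = 1 := by omega
  obtain ⟨u, hU⟩ := Set.ncard_eq_one.1 this
  have hs1 := Set.ext_iff.1 m4
  have hs2 := Set.ext_iff.1 m5
  have hs3 := Set.ext_iff.1 hU
  simp only [Set.mem_sdiff, Set.mem_inter_iff, Set.mem_insert_iff, Set.mem_singleton_iff]
    at hs1 hs2 hs3
  have key : ∀ a b, a ≠ b → a ≠ c → b ≠ c → degS M₂ a = 0 →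
      (∀ x, x ∈ oddSet M₁ ∧ x ∉ oddSet M₂ ↔ x = a ∨ x = b ∨ x = c) →
      ¬ M₁.Reachable a u → Cov 2 (M₁ ∆ M₂) := by
    intro a b hab hac hbc ha2 hs1 hr
    have hau : a ≠ u := by grind
    have am1 : a ∈ oddSet M₁ := by grind
    have um1 : u ∈ oddSet M₁ := by grind
    have um2 : u ∈ oddSet M₂ := by grind
    refine m1.cov_join m2 hau (m1.deg_le_one am1) (by omega) (m1.deg_le_one um1)
      (m2.deg_le_one um2) hr (not_reachable_of_isolated hau ha2) (x₁ := b) (y₁ := c)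
      (x₂ := a) (y₂ := d) ?_ ?_ <;> intro w hw <;>
      simp only [Set.mem_symmDiff, Set.mem_insert_iff, Set.mem_singleton_iff] at hw ⊢ <;> grind
  have := m1.leaf_pairs (p := a) (q := b) (r := u) (by grind) (by grind) (by grind) hab
    (by grind) (by grind)
  by_cases hr : M₁.Reachable a u
  · exact key b a hab.symm hbc hac hb2 (fun x => by rw [hs1 x]; tauto) (by tauto)
  · exact key a b hab hac hbc ha2 hs1 hr

theorem cov_two_of_two_two_aux [Finite α] {M₁ M₂ : SimpleGraph α} (m1 : LF M₁) (m2 : LF M₂)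
    {a b c d u u' : α} (hab : a ≠ b) (hcd : c ≠ d) (huu : u ≠ u')
    (hs1 : ∀ x, x ∈ oddSet M₁ ∧ x ∉ oddSet M₂ ↔ x = a ∨ x = b)
    (hs2 : ∀ x, x ∈ oddSet M₂ ∧ x ∉ oddSet M₁ ↔ x = c ∨ x = d)
    (hs3 : ∀ x, x ∈ oddSet M₁ ∧ x ∈ oddSet M₂ ↔ x = u ∨ x = u')
    (ha : degS M₂ a = 0) (hc : degS M₁ c = 0) (hr : M₁.Reachable u u') : Cov 2 (M₁ ∆ M₂) := by
  have key : ∀ u u', u ≠ u' → (∀ x, x ∈ oddSet M₁ ∧ x ∈ oddSet M₂ ↔ x = u ∨ x = u') →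
      M₁.Reachable u u' → ¬ M₂.Reachable c u' → Cov 2 (M₁ ∆ M₂) := by
    intro u u' huu hs3 hr hcu
    have am1 : a ∈ oddSet M₁ := by grind
    have cm2 : c ∈ oddSet M₂ := by grind
    have um1 : u ∈ oddSet M₁ := by grind
    have um2 : u ∈ oddSet M₂ := by grind
    have vm1 : u' ∈ oddSet M₁ := by grind
    have vm2 : u' ∈ oddSet M₂ := by grind
    have hau : a ≠ u := by grind
    have hav : a ≠ u' := by grind
    have hca : c ≠ a := by grind
    have hcu' : c ≠ u := by grind
    have hcv : c ≠ u' := by grind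
    have hnr : ¬ M₁.Reachable a u := fun h =>
      (m1.leaf_pairs am1 um1 vm1 hau hav huu).2.1 ⟨h, hr⟩
    have hnr2 := not_reachable_of_isolated hau ha
    have k1 := m1.add_edge hau (m1.deg_le_one am1) (m1.deg_le_one um1) hnr
    have k2 := m2.add_edge hau (by omega) (m2.deg_le_one um2) hnr2
    have dc := fun L => degS_flip_of_ne (G := L) hau hca hcu'
    have dv := fun L => degS_flip_of_ne (G := L) hau hav.symm huu.symm
    rw [← flip_symmDiff_flip M₁ M₂ a u]
    refine k1.cov_join k2 hcv (by rw [dc]; omega) (by rw [dc]; exact m2.deg_le_one cm2)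
      (by rw [dv]; exact m1.deg_le_one vm1) (by rw [dv]; exact m2.deg_le_one vm2)
      (not_reachable_of_isolated hcv (by rw [dc]; exact hc))
      (fun h => hcu (reachable_of_pendant (degS_eq_zero_iff.1 ha) hau hca hav.symm
        (by rwa [flip_comm] at h)))
      (x₁ := b) (y₁ := c) (x₂ := d) (y₂ := a) ?_ ?_ <;> rw [oddSet_flip _ hau] <;> intro w hw <;>
      simp only [Set.mem_symmDiff, Set.mem_insert_iff, Set.mem_singleton_iff] at hw ⊢ <;> grind
  have cm := (hs2 c).2 (Or.inl rfl)
  have um := (hs3 u).2 (Or.inl rfl)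
  have um' := (hs3 u').2 (Or.inr rfl)
  have := m2.leaf_pairs (p := c) (q := u) (r := u') (by grind) (by grind) (by grind) (by grind)
    (by grind) huu
  by_cases hcu : M₂.Reachable c u'
  · exact key u' u huu.symm (fun x => by rw [hs3 x, or_comm]) hr.symm (by tauto)
  · exact key u u' huu hs3 hr hcu

theorem cov_two_of_two_two [Finite α] {L₁ L₂ : SimpleGraph α} (h1 : LF L₁) (h2 : LF L₂)
    {a b c d : α} (hab : a ≠ b) (hcd : c ≠ d)
    (o1 : oddSet L₁ \ oddSet L₂ = {a, b}) (o2 : oddSet L₂ \ oddSet L₁ = {c, d})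
    (ha : degS L₂ a = 0) (hc : degS L₁ c = 0) : Cov 2 (L₁ ∆ L₂) := by
  obtain ⟨M₁, M₂, m1, m2, m3, m4, m5, m6, -, m8⟩ := reduce_two _ L₁ L₂ h1 h2 le_rfl
  rw [o1] at m4
  rw [o2] at m5
  have am : a ∈ oddSet L₁ \ oddSet L₂ := by rw [o1]; simp
  have cm : c ∈ oddSet L₂ \ oddSet L₁ := by rw [o2]; simp
  have ha2 : degS M₂ a = 0 := by rw [(m8 a (fun h => am.2 h.2)).2, ha]
  have hc2 : degS M₁ c = 0 := by rw [(m8 c (fun h => cm.2 h.1)).1, hc]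
  rw [← m3]
  have e2 := ncard_diff_parity (L := M₂) (oddSet M₁)
  rw [m5, Set.ncard_pair hcd, Set.inter_comm, Nat.even_iff] at e2
  have : (oddSet M₁ ∩ oddSet M₂).ncard = 0 ∨ (oddSet M₁ ∩ oddSet M₂).ncard = 2 := by omega
  have hs1 := Set.ext_iff.1 m4
  have hs2 := Set.ext_iff.1 m5
  simp only [Set.mem_sdiff, Set.mem_insert_iff, Set.mem_singleton_iff] at hs1 hs2
  rcases this with h0 | hu
  · rw [Set.ncard_eq_zero] at h0
    have h0 := Set.ext_iff.1 h0
    simp only [Set.mem_inter_iff, Set.mem_empty_iff_false] at h0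
    refine (m1.cov (ncard_le_two_of_subset (x := a) (y := b) ?_)).add
      (m2.cov (ncard_le_two_of_subset (x := c) (y := d) ?_)) <;> intro w hw <;> grind
  · obtain ⟨u, u', huu, hU⟩ := Set.ncard_eq_two.1 hu
    have hs3 := Set.ext_iff.1 hU
    simp only [Set.mem_inter_iff, Set.mem_insert_iff, Set.mem_singleton_iff] at hs3
    by_cases hr1 : M₁.Reachable u u'
    · exact cov_two_of_two_two_aux m1 m2 hab hcd huu hs1 hs2 hs3 ha2 hc2 hr1
    by_cases hr2 : M₂.Reachable u u'
    · rw [symmDiff_comm]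
      exact cov_two_of_two_two_aux m2 m1 hcd hab huu hs2 hs1 (fun x => by rw [and_comm, hs3])
        hc2 ha2 hr2
    have um1 : u ∈ oddSet M₁ := by grind
    have um2 : u ∈ oddSet M₂ := by grind
    have vm1 : u' ∈ oddSet M₁ := by grind
    have vm2 : u' ∈ oddSet M₂ := by grind
    refine m1.cov_join m2 huu (m1.deg_le_one um1) (m2.deg_le_one um2) (m1.deg_le_one vm1)
      (m2.deg_le_one vm2) hr1 hr2 (x₁ := a) (y₁ := b) (x₂ := c) (y₂ := d) ?_ ?_ <;> intro w hw <;>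
      simp only [Set.mem_symmDiff, Set.mem_insert_iff, Set.mem_singleton_iff] at hw ⊢ <;> grind

theorem degS_bot [Finite α] (v : α) : degS (⊥ : SimpleGraph α) v = 0 :=
  degS_eq_zero_iff.2 (by simp)

theorem not_cyc_of_degS_ne {L : SimpleGraph α} {v : α} (h : degS L v ≠ 2) : ¬ Cyc L v :=
  fun hc => h hc.self

/-- Cutting all cycles of a graph of maximum degree two. -/
theorem exists_cut_layer [Finite α] {F M : SimpleGraph α} (hF : ∀ v, degS F v ≤ 2) (hM : LF M)
    (hc : ∀ v, Cyc F v → degS M v ≤ 1) :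
    ∃ L₁ L₂ : SimpleGraph α, LF L₁ ∧ LF L₂ ∧ L₁ ≤ F ∧ L₁ ∆ L₂ = F ∆ M ∧
      ∀ w, ¬ Cyc F w → degS L₁ w = degS F w ∧ degS L₂ w = degS M w := by
  have hA : Absorb F ⊥ M := by
    refine ⟨hF, fun v => by simp [degS_bot], fun v => ?_, hM, hc,
      fun v hv => absurd hv (not_cyc_of_degS_ne (by simp [degS_bot]))⟩
    have := hF v
    have := hM.1 v
    rw [degS_bot]; omega
  obtain ⟨L₁, B, L₂, h⟩ := hA.exists_cut ∅
  have hB : B = ⊥ := le_bot_iff.1 h.le₂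
  have hs := h.sum_eq
  rw [hB, symmDiff_bot, symmDiff_bot] at hs
  refine ⟨L₁, L₂, ⟨h.absorb.d₁, fun x hx => ?_⟩, h.absorb.lf, h.le₁, hs, fun w hw => ⟨?_, ?_⟩⟩
  · obtain ⟨v, hv, -⟩ := h.cyc₁ x hx
    exact hv.elim
  · exact degS_congr (h.adj₁ w fun hc => absurd hc hw)
  · exact degS_congr (h.adj₃ w (fun hc => absurd hc hw)
      fun hc => absurd hc (not_cyc_of_degS_ne (by simp [degS_bot])))

/-- Cutting all cycles of a graph of maximum degree two while avoiding a given vertex. -/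
theorem exists_cut_layer_avoiding [Finite α] {F M : SimpleGraph α} (hF : ∀ v, degS F v ≤ 2)
    (hM : LF M) (hc : ∀ v, Cyc F v → degS M v = 0) (d : α) :
    ∃ L₁ L₂ : SimpleGraph α, LF L₁ ∧ LF L₂ ∧ L₁ ≤ F ∧ L₁ ∆ L₂ = F ∆ M ∧ degS L₂ d = degS M d ∧
      ∀ w, ¬ Cyc F w → degS L₁ w = degS F w ∧ degS L₂ w = degS M w := by
  by_cases hd : Cyc F d
  · obtain ⟨h, k, _, hn⟩ := degS_eq_two_iff.1 hd.self
    have hdh : F.Adj d h := (hn h).2 (Or.inl rfl)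
    have ch := hd.of_reachable hdh.reachable
    obtain ⟨h', hhh', hne⟩ : ∃ h', F.Adj h h' ∧ h' ≠ d := by
      obtain ⟨p, q, hpq, hn'⟩ := degS_eq_two_iff.1 ch.self
      by_cases hp : p = d
      · exact ⟨q, (hn' q).2 (Or.inr rfl), by rintro rfl; exact hpq hp⟩
      · exact ⟨p, (hn' p).2 (Or.inl rfl), hp⟩
    have ch' := ch.of_reachable hhh'.reachable
    have hM' := hM.add_edge hhh'.ne (by rw [hc h ch]; omega) (by rw [hc h' ch']; omega)
      (not_reachable_of_isolated hhh'.ne (hc h ch))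
    have hle := flip_le hhh'
    have hcyc : ∀ v, Cyc (F ∆ SimpleGraph.edge h h') v → Cyc F v ∧ ¬ F.Reachable v h :=
      fun v hv => hv.of_sub_edge hF hhh'
    obtain ⟨L₁, L₂, l1, l2, l3, l4, l5⟩ := exists_cut_layer
      (F := F ∆ SimpleGraph.edge h h') (M := M ∆ SimpleGraph.edge h h')
      (fun v => (degS_mono hle v).trans (hF v)) hM' (by
        intro v hv
        obtain ⟨h1, h2⟩ := hcyc v hv
        rw [degS_flip_of_ne hhh'.ne (by rintro rfl; exact h2 (SimpleGraph.Reachable.refl _))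
          (by rintro rfl; exact h2 hhh'.symm.reachable), hc v h1]
        omega)
    refine ⟨L₁, L₂, l1, l2, l3.trans hle, by rw [l4, flip_symmDiff_flip], ?_, ?_⟩
    · rw [(l5 d (fun hv => (hcyc d hv).2 hdh.reachable)).2,
        degS_flip_of_ne hhh'.ne hdh.ne hne.symm]
    · intro w hw
      have hwh : w ≠ h := by rintro rfl; exact hw ch
      have hwh' : w ≠ h' := by rintro rfl; exact hw ch'
      have := l5 w (fun hv => hw (hcyc w hv).1)
      rwa [degS_flip_of_ne hhh'.ne hwh hwh', degS_flip_of_ne hhh'.ne hwh hwh'] at this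
  · obtain ⟨L₁, L₂, l1, l2, l3, l4, l5⟩ :=
      exists_cut_layer hF hM (fun v hv => by rw [hc v hv]; omega)
    exact ⟨L₁, L₂, l1, l2, l3, l4, (l5 d hd).2, l5⟩

theorem degS_le_two_of_isPolycycle {F : SimpleGraph α} (hF : IsPolycycle F) (v : α) :
    degS F v ≤ 2 := by
  rcases hF v with h | h <;> omega

theorem oddSet_of_isPolycycle {F : SimpleGraph α} (hF : IsPolycycle F) : oddSet F = ∅ := by
  ext v
  rw [mem_oddSet]
  rcases hF v with h | h <;> rw [h] <;> simp

theorem isPolycycle_of_oddSet {F : SimpleGraph α} (hF : ∀ v, degS F v ≤ 2) (h : oddSet F = ∅) :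
    IsPolycycle F := by
  intro v
  have h1 := hF v
  have h2 : ¬ Odd (degS F v) := by rw [← mem_oddSet, h]; simp
  rw [Nat.odd_iff] at h2
  omega

theorem cov_two_of_isPolycycle [Finite α] {F : SimpleGraph α} (hF : IsPolycycle F) : Cov 2 F := by
  obtain ⟨L₁, L₂, l1, l2, -, l4, -⟩ := exists_cut_layer (degS_le_two_of_isPolycycle hF) lf_bot
    (fun v _ => by rw [degS_bot]; omega)
  rw [symmDiff_bot] at l4
  have := oddSet_of_isPolycycle hF
  rw [← l4, oddSet_symmDiff, ← Set.bot_eq_empty, symmDiff_eq_bot] at this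
  rw [← l4]
  exact cov_two_of_oddSet_eq l1 l2 this

theorem degS_eq_one_of_mem_oddSet {F : SimpleGraph α} (hF : ∀ v, degS F v ≤ 2) {v : α}
    (h : v ∈ oddSet F) : degS F v = 1 := by
  have := hF v
  rw [mem_oddSet, Nat.odd_iff] at h
  omega

theorem cov_two_layer [Finite α] {F : SimpleGraph α} (hF : ∀ v, degS F v ≤ 2) {a b : α}
    (ho : oddSet F = {a, b}) : Cov 2 F := by
  obtain ⟨L₁, L₂, l1, l2, -, l4, l5⟩ := exists_cut_layer hF lf_bot
    (fun v _ => by rw [degS_bot]; omega)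
  rw [symmDiff_bot] at l4
  have da := degS_eq_one_of_mem_oddSet hF (v := a) (by rw [ho]; simp)
  have db := degS_eq_one_of_mem_oddSet hF (v := b) (by rw [ho]; simp)
  have la := l5 a (not_cyc_of_degS_ne (by omega))
  have lb := l5 b (not_cyc_of_degS_ne (by omega))
  rw [da, degS_bot] at la
  rw [db, degS_bot] at lb
  have oa1 : a ∈ oddSet L₁ := by rw [mem_oddSet, la.1]; exact odd_one
  have ob1 : b ∈ oddSet L₁ := by rw [mem_oddSet, lb.1]; exact odd_one
  have oa2 : a ∉ oddSet L₂ := by rw [mem_oddSet, la.2]; simp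
  have ob2 : b ∉ oddSet L₂ := by rw [mem_oddSet, lb.2]; simp
  rw [← l4, oddSet_symmDiff] at ho
  have ho' := Set.ext_iff.1 ho
  simp only [Set.mem_symmDiff, Set.mem_insert_iff, Set.mem_singleton_iff] at ho'
  rw [← l4]
  refine cov_two_of_pair l1 l2 (a := a) (b := b) ?_ ?_ la.2 <;> ext w <;>
    simp only [Set.mem_sdiff, Set.mem_insert_iff, Set.mem_singleton_iff,
      Set.mem_empty_iff_false] <;>
    grind

/-- Adding an edge at an isolated vertex to a layer. -/
theorem cov_two_layer_edge_of_isolated [Finite α] {F : SimpleGraph α} (hF : ∀ v, degS F v ≤ 2)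
    {a b c d : α} (hab : a ≠ b) (ho : oddSet F = {a, b}) (hcd : c ≠ d) (hca : c ≠ a)
    (hda : d ≠ a) (hdb : d ≠ b) (hc : degS F c = 0) : Cov 2 (F ∆ SimpleGraph.edge c d) := by
  obtain ⟨L₁, L₂, l1, l2, l3, l4, l5, l6⟩ := exists_cut_layer_avoiding hF lf_bot
    (fun v _ => degS_bot v) d
  rw [symmDiff_bot] at l4
  rw [degS_bot] at l5
  have da := degS_eq_one_of_mem_oddSet hF (v := a) (by rw [ho]; simp)
  have db := degS_eq_one_of_mem_oddSet hF (v := b) (by rw [ho]; simp)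
  have la := l6 a (not_cyc_of_degS_ne (by omega))
  have lb := l6 b (not_cyc_of_degS_ne (by omega))
  have lc := l6 c (not_cyc_of_degS_ne (by omega))
  rw [da, degS_bot] at la
  rw [db, degS_bot] at lb
  rw [hc, degS_bot] at lc
  have oa1 : a ∈ oddSet L₁ := by rw [mem_oddSet, la.1]; exact odd_one
  have ob1 : b ∈ oddSet L₁ := by rw [mem_oddSet, lb.1]; exact odd_one
  have oa2 : a ∉ oddSet L₂ := by rw [mem_oddSet, la.2]; simp
  have ob2 : b ∉ oddSet L₂ := by rw [mem_oddSet, lb.2]; simp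
  have oc1 : c ∉ oddSet L₁ := by rw [mem_oddSet, lc.1]; simp
  have oc2 : c ∉ oddSet L₂ := by rw [mem_oddSet, lc.2]; simp
  have od2 : d ∉ oddSet L₂ := by rw [mem_oddSet, l5]; simp
  rw [← l4, oddSet_symmDiff] at ho
  have ho' := Set.ext_iff.1 ho
  simp only [Set.mem_symmDiff, Set.mem_insert_iff, Set.mem_singleton_iff] at ho'
  have k2 := l2.add_edge hcd (by omega) (by omega) (not_reachable_of_isolated hcd lc.2)
  rw [← l4, symmDiff_assoc]
  refine cov_two_of_two_two l1 k2 hab hcd ?_ ?_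
    (by rw [degS_flip_of_ne hcd hca.symm hda.symm, la.2]) lc.1 <;> rw [oddSet_flip _ hcd] <;> ext w <;>
    simp only [Set.mem_sdiff, Set.mem_insert_iff, Set.mem_singleton_iff, Set.mem_symmDiff] <;>
    grind

theorem cov_two_layer_edge_of_neighbor [Finite α] {F : SimpleGraph α} (hF : ∀ v, degS F v ≤ 2)
    {a b c d c' : α} (hab : a ≠ b) (ho : oddSet F = {a, b}) (hcd : c ≠ d) (hca : c ≠ a)
    (hcb : c ≠ b) (hda : d ≠ a) (hdb : d ≠ b) (hc : degS F c = 2)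
    (hcc' : F.Adj c c') (hc'a : c' ≠ a) (hc'b : c' ≠ b) (hc'd : c' ≠ d) :
    Cov 2 (F ∆ SimpleGraph.edge c d) := by
  have hne := hcc'.ne
  have fle := flip_le hcc'
  have hedge : ∀ w, w ≠ c → w ≠ c' → degS (SimpleGraph.edge c c') w = 0 := by
    intro w h1 h2
    have := degS_flip_of_ne (G := (⊥ : SimpleGraph α)) hne h1 h2
    rwa [bot_symmDiff, degS_bot] at this
  have hec : degS (SimpleGraph.edge c c') c = 1 := by
    have := degS_flip_add (G := (⊥ : SimpleGraph α)) hne (by simp)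
    rwa [bot_symmDiff, degS_bot] at this
  have hlf : LF (SimpleGraph.edge c c') := by
    have := (lf_bot (α := α)).add_edge hne (by simp [degS_bot]) (by simp [degS_bot])
      (not_reachable_of_isolated hne (degS_bot _))
    rwa [bot_symmDiff] at this
  obtain ⟨L₁, L₂, l1, l2, l3, l4, l5, l6⟩ := exists_cut_layer_avoiding
    (F := F ∆ SimpleGraph.edge c c') (M := SimpleGraph.edge c c')
    (fun v => (degS_mono fle v).trans (hF v)) hlf
    (fun v hv => by
      have := (hv.of_sub_edge hF hcc').2
      exact hedge v (by rintro rfl; exact this (SimpleGraph.Reachable.refl _))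
        (by rintro rfl; exact this hcc'.symm.reachable)) d
  rw [symmDiff_symmDiff_cancel_right] at l4
  rw [hedge d hcd.symm hc'd.symm] at l5
  have da := degS_eq_one_of_mem_oddSet hF (v := a) (by rw [ho]; simp)
  have db := degS_eq_one_of_mem_oddSet hF (v := b) (by rw [ho]; simp)
  have da' := degS_flip_of_ne (G := F) hne hca.symm hc'a.symm
  have db' := degS_flip_of_ne (G := F) hne hcb.symm hc'b.symm
  have dc' := degS_flip_sub hcc'
  have la := l6 a (not_cyc_of_degS_ne (by omega))
  have lb := l6 b (not_cyc_of_degS_ne (by omega))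
  have lc := l6 c (not_cyc_of_degS_ne (by omega))
  rw [hedge a hca.symm hc'a.symm] at la
  rw [hedge b hcb.symm hc'b.symm] at lb
  rw [hec] at lc
  have oa1 : a ∈ oddSet L₁ := by rw [mem_oddSet, la.1, da', da]; exact odd_one
  have ob1 : b ∈ oddSet L₁ := by rw [mem_oddSet, lb.1, db', db]; exact odd_one
  have oa2 : a ∉ oddSet L₂ := by rw [mem_oddSet, la.2]; simp
  have ob2 : b ∉ oddSet L₂ := by rw [mem_oddSet, lb.2]; simp
  have oc2 : c ∈ oddSet L₂ := by rw [mem_oddSet, lc.2]; exact odd_one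
  have od2 : d ∉ oddSet L₂ := by rw [mem_oddSet, l5]; simp
  rw [← l4, oddSet_symmDiff] at ho
  have ho' := Set.ext_iff.1 ho
  simp only [Set.mem_symmDiff, Set.mem_insert_iff, Set.mem_singleton_iff] at ho'
  have k2 := l2.add_edge hcd (by omega) (by omega)
    (fun h => not_reachable_of_isolated hcd.symm l5 h.symm)
  rw [← l4, symmDiff_assoc]
  refine cov_two_of_three_one l1 k2 hab hca.symm hcb.symm (d := d) ?_ ?_
    (by rw [degS_flip_of_ne hcd hca.symm hda.symm, la.2])
    (by rw [degS_flip_of_ne hcd hcb.symm hdb.symm, lb.2]) <;>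
    rw [oddSet_flip _ hcd] <;> ext w <;>
    simp only [Set.mem_sdiff, Set.mem_insert_iff, Set.mem_singleton_iff, Set.mem_symmDiff] <;>
    grind

/-- The graph is a path `a, c, d, b` plus cycles. -/
theorem cov_two_layer_edge_of_short [Finite α] {F : SimpleGraph α} (hF : ∀ v, degS F v ≤ 2)
    {a b c d : α} (hab : a ≠ b) (ho : oddSet F = {a, b}) (hcd : c ≠ d) (hca : c ≠ a)
    (hcb : c ≠ b) (hda : d ≠ a) (hdb : d ≠ b) (hd : degS F d = 2)
    (h1 : F.Adj c d) (h2 : F.Adj d b) : Cov 2 (F ∆ SimpleGraph.edge c d) := by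
  have fle := flip_le h1
  have h2' : (F ∆ SimpleGraph.edge c d).Adj d b := by
    rw [flip_adj hcd]; simp [h2, hcb.symm, hdb.symm]
  have fle' := flip_le h2'
  have e1 := degS_flip_sub' h1
  have e2 := degS_flip_sub h2'
  have := cov_two_layer_edge_of_isolated (F := F ∆ SimpleGraph.edge c d ∆ SimpleGraph.edge d b)
    (fun v => (degS_mono (fle'.trans fle) v).trans (hF v)) (a := a) (b := c) (c := d) (d := b)
    hca.symm (by
      rw [oddSet_flip _ hdb, oddSet_flip _ hcd, ho]; ext w
      simp only [Set.mem_symmDiff, Set.mem_insert_iff, Set.mem_singleton_iff]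
      grind) hdb hda hab.symm hcb.symm (by omega)
  rwa [symmDiff_symmDiff_cancel_right] at this

/-- Adding an edge to a layer with two odd vertices, away from those vertices. -/
theorem cov_two_layer_edge [Finite α] {F : SimpleGraph α} (hF : ∀ v, degS F v ≤ 2)
    {a b c d : α} (hab : a ≠ b) (ho : oddSet F = {a, b}) (hcd : c ≠ d) (hca : c ≠ a)
    (hcb : c ≠ b) (hda : d ≠ a) (hdb : d ≠ b) : Cov 2 (F ∆ SimpleGraph.edge c d) := by
  have heven : ∀ v, v ≠ a → v ≠ b → degS F v = 0 ∨ degS F v = 2 := by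
    intro v h1 h2
    have : v ∉ oddSet F := by rw [ho]; simp [h1, h2]
    rw [mem_oddSet, Nat.odd_iff] at this
    have := hF v
    omega
  rcases heven c hca hcb with hc | hc
  · exact cov_two_layer_edge_of_isolated hF hab ho hcd hca hda hdb hc
  rcases heven d hda hdb with hd | hd
  · rw [flip_comm]
    exact cov_two_layer_edge_of_isolated hF hab ho hcd.symm hda hca hcb hd
  by_cases h1 : ∃ c', F.Adj c c' ∧ c' ≠ a ∧ c' ≠ b ∧ c' ≠ d
  · obtain ⟨c', h, h2, h3, h4⟩ := h1
    exact cov_two_layer_edge_of_neighbor hF hab ho hcd hca hcb hda hdb hc h h2 h3 h4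
  by_cases h2 : ∃ d', F.Adj d d' ∧ d' ≠ a ∧ d' ≠ b ∧ d' ≠ c
  · obtain ⟨d', h, h2, h3, h4⟩ := h2
    rw [flip_comm]
    exact cov_two_layer_edge_of_neighbor hF hab ho hcd.symm hda hdb hca hcb hd h h2 h3 h4
  push Not at h1 h2
  have da := degS_le_one_iff.1 (degS_eq_one_of_mem_oddSet hF (v := a) (by rw [ho]; simp)).le
  have db := degS_le_one_iff.1 (degS_eq_one_of_mem_oddSet hF (v := b) (by rw [ho]; simp)).le
  obtain ⟨p, q, hpq, hn⟩ := degS_eq_two_iff.1 hd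
  obtain ⟨r, s, hrs, hm⟩ := degS_eq_two_iff.1 hc
  have hp := (hn p).2 (Or.inl rfl)
  have hq := (hn q).2 (Or.inr rfl)
  have hr := (hm r).2 (Or.inl rfl)
  have hs := (hm s).2 (Or.inr rfl)
  have hadj : F.Adj c d := by
    by_contra hnadj
    have hrd : r ≠ d := by rintro rfl; exact hnadj hr
    have hsd : s ≠ d := by rintro rfl; exact hnadj hs
    have ha : F.Adj c a := by grind
    have hb : F.Adj c b := by grind
    have hpc : p ≠ c := by rintro rfl; exact hnadj hp.symm
    have hpab : p = a ∨ p = b := by grind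
    rcases hpab with rfl | rfl
    · exact hcd (da c d ha.symm hp.symm)
    · exact hcd (db c d hb.symm hp.symm)
  have hdab : F.Adj d a ∨ F.Adj d b := by grind
  rcases hdab with h | h
  · exact cov_two_layer_edge_of_short hF hab.symm (by rw [ho, Set.pair_comm]) hcd hcb hca hdb hda hd
      hadj h
  · exact cov_two_layer_edge_of_short hF hab ho hcd hca hcb hda hdb hd hadj h

theorem symmDiff_move_two (a b c e f : SimpleGraph α) :
    (a ∆ e) ∆ (b ∆ f) ∆ (c ∆ e ∆ f) = a ∆ b ∆ c := by
  rw [symmDiff_symmDiff_symmDiff_comm a e b f, symmDiff_assoc c e f,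
    symmDiff_symmDiff_symmDiff_comm, symmDiff_self, symmDiff_bot]

theorem odd_or_odd_of_inter_symmDiff [Finite α] {P S T : Set α} {z : α} (h : P ∩ (S ∆ T) = {z}) :
    Odd (P ∩ S).ncard ∨ Odd (P ∩ T).ncard := by
  have h1 : (P ∩ S) ∆ (P ∩ T) = {z} := by rw [← Set.inter_symmDiff_distrib_left, h]
  have h2 := odd_ncard_symmDiff (P ∩ S) (P ∩ T)
  rw [h1, Set.ncard_singleton] at h2
  have := h2.1 odd_one
  tauto

/-- Cutting one cycle of a polycycle, away from two given vertices. -/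
theorem exists_absorb_at [Finite α] {A B : SimpleGraph α} (hA : IsPolycycle A) (hB : IsPolycycle B)
    {v b : α} (hv : degS A v = 2) :
    ∃ L₁ L₃, Absorb L₁ B L₃ ∧ L₁ ≤ A ∧ L₁ ∆ B ∆ L₃ = A ∆ B ∧ degS L₃ v = 0 ∧ degS L₃ b = 0 ∧
      Cyc L₁ v ∧ (Cyc L₁ b → L₁.Reachable b v) := by
  have h0 : Absorb A B ⊥ := by
    refine ⟨degS_le_two_of_isPolycycle hA, degS_le_two_of_isPolycycle hB, fun w => ?_, lf_bot,
      fun w _ => by rw [degS_bot]; omega, fun w _ => by rw [degS_bot]; omega⟩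
    have := degS_le_two_of_isPolycycle hA w
    have := degS_le_two_of_isPolycycle hB w
    rw [degS_bot]; omega
  have cv := cyc_of_isPolycycle hA hv
  by_cases hc : Cyc A b ∧ ¬ A.Reachable b v
  · obtain ⟨cb, hr⟩ := hc
    obtain ⟨h, k, _, hn⟩ := degS_eq_two_iff.1 cb.self
    have hbh : A.Adj b h := (hn h).2 (Or.inl rfl)
    have ch := cb.of_reachable hbh.reachable
    obtain ⟨h', hhh', hne⟩ : ∃ h', A.Adj h h' ∧ h' ≠ b := by
      obtain ⟨p, q, hpq, hn'⟩ := degS_eq_two_iff.1 ch.self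
      by_cases hp : p = b
      · exact ⟨q, (hn' q).2 (Or.inr rfl), by rintro rfl; exact hpq hp⟩
      · exact ⟨p, (hn' p).2 (Or.inl rfl), hp⟩
    have hbh' : A.Reachable b h' := hbh.reachable.trans hhh'.reachable
    have hvr : ∀ y, A.Reachable v y → y ≠ h ∧ y ≠ h' := by
      intro y hy
      constructor
      · rintro rfl; exact hr (hbh.reachable.trans hy.symm)
      · rintro rfl; exact hr (hbh'.trans hy.symm)
    have hvv := hvr v (SimpleGraph.Reachable.refl v)
    refine ⟨A ∆ SimpleGraph.edge h h', ⊥ ∆ SimpleGraph.edge h h',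
      h0.move ch hhh' (not_reachable_of_isolated hhh'.ne (degS_bot h)), flip_le hhh', ?_, ?_, ?_,
      ?_, ?_⟩
    · rw [symmDiff_right_comm A, flip_symmDiff_flip, symmDiff_bot]
    · rw [degS_flip_of_ne hhh'.ne hvv.1 hvv.2, degS_bot]
    · rw [degS_flip_of_ne hhh'.ne hbh.ne hne.symm, degS_bot]
    · intro y hy
      have hy' := hy.mono (flip_le hhh')
      rw [degS_flip_of_ne hhh'.ne (hvr y hy').1 (hvr y hy').2]
      exact cv y hy'
    · intro hcb
      exact absurd hbh.reachable (hcb.of_sub_edge (degS_le_two_of_isPolycycle hA) hhh').2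
  · refine ⟨A, ⊥, h0, le_rfl, symmDiff_bot _, degS_bot v, degS_bot b, cv, fun h => ?_⟩
    by_contra hn
    exact hc ⟨h, hn⟩

/-- Two edge-disjoint polycycles with a common vertex, with their cycles cut down to those through
that vertex. -/
theorem exists_absorb_common [Finite α] {A B : SimpleGraph α} (hA : IsPolycycle A)
    (hB : IsPolycycle B) {v b : α} (hv : degS A v = 2) (hvb : B.Adj v b) :
    ∃ M₁ M₂ M₃, Absorb M₁ M₂ M₃ ∧ M₁ ≤ A ∧ M₂ ≤ B ∧ M₁ ∆ M₂ ∆ M₃ = A ∆ B ∧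
      degS M₃ v = 0 ∧ degS M₃ b = 0 ∧ Cyc M₁ v ∧ (∀ w, Cyc M₁ w → M₁.Reachable w v) ∧
      Cyc M₂ v ∧ (∀ w, Cyc M₂ w → M₂.Reachable w v) ∧
      ∀ w, B.Reachable v w → ∀ y, M₂.Adj w y ↔ B.Adj w y := by
  obtain ⟨L₁, L₃, h1, h2, h3, h4, h5, h6, h7⟩ := exists_absorb_at hA hB (b := b) hv
  obtain ⟨M₁, M₂, M₃, h⟩ := h1.exists_cut {v}
  have cB : Cyc B v := cyc_of_isPolycycle hB (by
    have := degS_pos_iff.2 ⟨b, hvb⟩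
    rcases hB v with h | h <;> omega)
  have p1 : ∀ w, L₁.Reachable v w → ∀ y, M₁.Adj w y ↔ L₁.Adj w y :=
    fun w hw => h.adj₁ w fun _ => ⟨v, rfl, hw.symm⟩
  have p2 : ∀ w, B.Reachable v w → ∀ y, M₂.Adj w y ↔ B.Adj w y :=
    fun w hw => h.adj₂ w fun _ => ⟨v, rfl, hw.symm⟩
  refine ⟨M₁, M₂, M₃, h.absorb, h.le₁.trans h2, h.le₂, h.sum_eq.trans h3, ?_, ?_, ?_, ?_, ?_, ?_,
    p2⟩
  · rw [← h4]
    exact degS_congr (h.adj₃ v (fun _ => ⟨v, rfl, .refl v⟩) (fun _ => ⟨v, rfl, .refl v⟩))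
  · rw [← h5]
    exact degS_congr (h.adj₃ b (fun hc => ⟨v, rfl, h7 hc⟩)
      (fun _ => ⟨v, rfl, hvb.symm.reachable⟩))
  · intro y hy
    have hy' := hy.mono h.le₁
    rw [degS_congr (p1 y hy')]
    exact h6 y hy'
  · intro w hw
    obtain ⟨_, rfl, hr⟩ := h.cyc₁ w hw
    exact (hw.of_le h.le₁ h1.d₁).2 _ hr
  · intro y hy
    have hy' := hy.mono h.le₂
    rw [degS_congr (p2 y hy')]
    exact cB y hy'
  · intro w hw
    obtain ⟨_, rfl, hr⟩ := h.cyc₂ w hw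
    exact (hw.of_le h.le₂ h1.d₂).2 _ hr

theorem lf_flip_of_cyc [Finite α] {M : SimpleGraph α} (hd : ∀ w, degS M w ≤ 2) {v p q : α}
    (h : ∀ w, Cyc M w → M.Reachable w v) (hpq : M.Adj p q) (hp : M.Reachable v p) :
    LF (M ∆ SimpleGraph.edge p q) :=
  ⟨fun w => (degS_mono (flip_le hpq) w).trans (hd w), fun w hw =>
    (hw.of_sub_edge hd hpq).2 ((h w (hw.of_sub_edge hd hpq).1).trans hp)⟩

theorem cov_three_of_common [Finite α] {A B : SimpleGraph α} (hA : IsPolycycle A)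
    (hB : IsPolycycle B) (hAB : ∀ x y, A.Adj x y → ¬ B.Adj x y) {v : α} (hvA : degS A v = 2)
    (hvB : degS B v = 2) : Cov 3 (A ∆ B) := by
  obtain ⟨b, b', -, hb⟩ := degS_eq_two_iff.1 hvB
  have hvb : B.Adj v b := (hb b).2 (Or.inl rfl)
  have cB : Cyc B v := cyc_of_isPolycycle hB hvB
  obtain ⟨c, hbc, hcv⟩ : ∃ c, B.Adj b c ∧ c ≠ v := by
    obtain ⟨p, q, hpq, hn'⟩ := degS_eq_two_iff.1 (cB.of_reachable hvb.reachable).self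
    by_cases hp : p = v
    · exact ⟨q, (hn' q).2 (Or.inr rfl), by rintro rfl; exact hpq hp⟩
    · exact ⟨p, (hn' p).2 (Or.inl rfl), hp⟩
  obtain ⟨M₁, M₂, M₃, h, le1, le2, hs, v3, b3, c1, r1, c2, r2, adj2⟩ :=
    exists_absorb_common hA hB hvA hvb
  have hvb2 : M₂.Adj v b := (adj2 v (.refl v) b).2 hvb
  have hbc2 : M₂.Adj b c := (adj2 b hvb.reachable c).2 hbc
  have cb2 : Cyc M₂ b := c2.of_reachable hvb2.reachable
  have cc2 : Cyc M₂ c := cb2.of_reachable hbc2.reachable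
  have c3 := h.c₂ c cc2
  obtain ⟨x, hvx, hxc, hxr⟩ : ∃ x, M₁.Adj v x ∧ x ≠ c ∧ ¬ M₃.Reachable x c := by
    obtain ⟨p, q, hpq, hn⟩ := degS_eq_two_iff.1 c1.self
    have hp := (hn p).2 (Or.inl rfl)
    have hq := (hn q).2 (Or.inr rfl)
    have cp := c1.of_reachable hp.reachable
    have cq := c1.of_reachable hq.reachable
    by_cases hpc : p = c
    · subst hpc
      have := h.sum p
      have := cp.self
      have := cc2.self
      exact ⟨q, hq, hpq.symm, fun hr => not_reachable_of_isolated hpq (by omega) hr.symm⟩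
    by_cases hqc : q = c
    · subst hqc
      have := h.sum q
      have := cq.self
      have := cc2.self
      exact ⟨p, hp, hpq, fun hr => not_reachable_of_isolated hpq.symm (by omega) hr.symm⟩
    by_cases hr : M₃.Reachable p c
    · refine ⟨q, hq, hqc, fun hr' => ?_⟩
      exact three_leaves h.lf.1 c3 (h.c₁ p cp) (h.c₁ q cq) (Ne.symm hpc) (Ne.symm hqc) hpq hr.symm
        hr'.symm
    · exact ⟨p, hp, hpc, hr⟩
  have hxb : x ≠ b := by
    rintro rfl
    exact hAB v x (le1 hvx) hvb
  have hnvx := hvx.ne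
  have hnvb := hvb.ne
  have hnbc := hbc.ne
  have x3 := h.c₁ x (c1.of_reachable hvx.reachable)
  have nvx3 : ¬ M₃.Adj v x := degS_eq_zero_iff.1 v3 x
  have P1 : LF (M₁ ∆ SimpleGraph.edge v x) := lf_flip_of_cyc h.d₁ r1 hvx (.refl v)
  have P2 : LF (M₂ ∆ SimpleGraph.edge v b) := lf_flip_of_cyc h.d₂ r2 hvb2 (.refl v)
  have P2' : LF (M₂ ∆ SimpleGraph.edge b c) := lf_flip_of_cyc h.d₂ r2 hbc2 hvb2.reachable
  have P3 : LF (M₃ ∆ SimpleGraph.edge v x) :=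
    h.lf.add_edge hnvx (by omega) x3 (not_reachable_of_isolated hnvx v3)
  have v3' := degS_flip_add hnvx nvx3
  have b3' : degS (M₃ ∆ SimpleGraph.edge v x) b = degS M₃ b :=
    degS_flip_of_ne hnvx hnvb.symm hxb.symm
  have c3' : degS (M₃ ∆ SimpleGraph.edge v x) c = degS M₃ c := degS_flip_of_ne hnvx hcv hxc.symm
  rw [b3] at b3'
  have P3α : LF (M₃ ∆ SimpleGraph.edge v x ∆ SimpleGraph.edge v b) :=
    P3.add_edge hnvb (by omega) (by omega)
      (fun hr => not_reachable_of_isolated hnvb.symm b3' hr.symm)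
  have heven : oddSet M₁ ∆ oddSet M₂ ∆ oddSet M₃ = ∅ := by
    rw [← oddSet_symmDiff, ← oddSet_symmDiff, hs, oddSet_symmDiff, oddSet_of_isPolycycle hA,
      oddSet_of_isPolycycle hB, symmDiff_self]
    rfl
  have he := Set.ext_iff.1 heven
  simp only [Set.mem_symmDiff, Set.mem_empty_iff_false] at he
  have v1o : v ∉ oddSet M₁ := by rw [mem_oddSet, c1.self]; decide
  have b2o : b ∉ oddSet M₂ := by rw [mem_oddSet, cb2.self]; decide
  have c2o : c ∉ oddSet M₂ := by rw [mem_oddSet, cc2.self]; decide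
  have b3o : b ∉ oddSet M₃ := by rw [mem_oddSet, b3]; decide
  have finish : ∀ {L₂ L₃ : SimpleGraph α}, LF L₂ → LF L₃ →
      (M₁ ∆ SimpleGraph.edge v x) ∆ L₂ ∆ L₃ = A ∆ B →
      Odd (oddSet (M₁ ∆ SimpleGraph.edge v x) ∩ oddSet L₂).ncard → Cov 3 (A ∆ B) := by
    intro L₂ L₃ l2 l3 hs' ho
    rw [← hs']
    refine three_forests P1 l2 l3 ?_ ho
    have : oddSet ((M₁ ∆ SimpleGraph.edge v x) ∆ L₂ ∆ L₃) = ∅ := by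
      rw [hs', oddSet_symmDiff, oddSet_of_isPolycycle hA, oddSet_of_isPolycycle hB, symmDiff_self]
      rfl
    rw [oddSet_symmDiff, oddSet_symmDiff, ← Set.bot_eq_empty, symmDiff_eq_bot] at this
    exact this.symm
  have eα : (M₁ ∆ SimpleGraph.edge v x) ∆ (M₂ ∆ SimpleGraph.edge v b) ∆
      (M₃ ∆ SimpleGraph.edge v x ∆ SimpleGraph.edge v b) = A ∆ B := by
    rw [← hs, symmDiff_move_two]
  have hcase : degS M₃ c = 0 ∨ degS M₃ c = 1 := by omega
  rcases hcase with c3 | c3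
  · have c3o : c ∉ oddSet M₃ := by rw [mem_oddSet, c3]; decide
    have P3β : LF (M₃ ∆ SimpleGraph.edge v x ∆ SimpleGraph.edge b c) :=
      P3.add_edge hnbc (by omega) (by omega) (not_reachable_of_isolated hnbc b3')
    have key : oddSet (M₁ ∆ SimpleGraph.edge v x) ∩ (oddSet (M₂ ∆ SimpleGraph.edge v b) ∆
        oddSet (M₂ ∆ SimpleGraph.edge b c)) = {v} := by
      rw [oddSet_flip _ hnvx, oddSet_flip _ hnvb, oddSet_flip _ hnbc]
      ext w
      simp only [Set.mem_inter_iff, Set.mem_symmDiff, Set.mem_insert_iff, Set.mem_singleton_iff]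
      have := he c
      grind
    rcases odd_or_odd_of_inter_symmDiff key with ho | ho
    · exact finish P2 P3α eα ho
    · refine finish P2' P3β ?_ ho
      rw [← hs, symmDiff_move_two]
  · have c3o : c ∈ oddSet M₃ := by rw [mem_oddSet, c3]; exact odd_one
    have hbcα : (M₂ ∆ SimpleGraph.edge v b).Adj b c := by
      rw [flip_adj hnvb]; simp [hbc2, hcv, hnbc.symm]
    have P2γ : LF (M₂ ∆ SimpleGraph.edge v b ∆ SimpleGraph.edge b c) := P2.of_le (flip_le hbcα)
    have b3α := degS_flip_add' (G := M₃ ∆ SimpleGraph.edge v x) hnvb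
      (fun hh => degS_eq_zero_iff.1 b3' v hh.symm)
    have c3α : degS (M₃ ∆ SimpleGraph.edge v x ∆ SimpleGraph.edge v b) c = _ :=
      degS_flip_of_ne hnvb hcv hnbc.symm
    have P3γ : LF (M₃ ∆ SimpleGraph.edge v x ∆ SimpleGraph.edge v b ∆ SimpleGraph.edge b c) := by
      refine P3α.add_edge hnbc (by omega) (by omega) fun hr => hxr ?_
      have hvb' : (M₃ ∆ SimpleGraph.edge v x ∆ SimpleGraph.edge v b).Adj v b := by
        rw [flip_adj hnvb]
        have : ¬ (M₃ ∆ SimpleGraph.edge v x).Adj v b := fun hh =>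
          degS_eq_zero_iff.1 b3' v hh.symm
        simp [this]
      have k1 := reachable_of_pendant (degS_eq_zero_iff.1 b3') hnvb.symm hnvb hnbc.symm
        (hvb'.reachable.trans hr)
      have hvx' : (M₃ ∆ SimpleGraph.edge v x).Adj x v := by
        rw [flip_adj hnvx]
        have : ¬ M₃.Adj x v := fun hh => nvx3 hh.symm
        simp [this]
      have k2 := hvx'.reachable.trans k1
      rw [flip_comm] at k2
      exact reachable_of_pendant (degS_eq_zero_iff.1 v3) hnvx hnvx.symm hcv k2
    have key : oddSet (M₁ ∆ SimpleGraph.edge v x) ∩ (oddSet (M₂ ∆ SimpleGraph.edge v b) ∆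
        oddSet (M₂ ∆ SimpleGraph.edge v b ∆ SimpleGraph.edge b c)) = {c} := by
      rw [oddSet_flip _ hnvx, oddSet_flip _ hnbc, oddSet_flip _ hnvb]
      ext w
      simp only [Set.mem_inter_iff, Set.mem_symmDiff, Set.mem_insert_iff, Set.mem_singleton_iff]
      have := he c
      have := he b
      grind
    rcases odd_or_odd_of_inter_symmDiff key with ho | ho
    · exact finish P2 P3α eα ho
    · refine finish P2γ P3γ ?_ ho
      rw [← eα, ← symmDiff_assoc (M₁ ∆ SimpleGraph.edge v x), flip_symmDiff_flip]

/-- The symmetric difference of two edge-disjoint polycycles has an odd-cover by three paths. -/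
theorem cov_three_of_disjoint [Finite α] {A B : SimpleGraph α} (hA : IsPolycycle A)
    (hB : IsPolycycle B) (hAB : ∀ x y, A.Adj x y → ¬ B.Adj x y) : Cov 3 (A ∆ B) := by
  by_cases hv : ∃ v, degS A v = 2 ∧ degS B v = 2
  · obtain ⟨v, h1, h2⟩ := hv
    exact cov_three_of_common hA hB hAB h1 h2
  · push Not at hv
    refine (cov_two_of_isPolycycle fun v => ?_).mono (by omega : 2 ≤ 3)
    rcases hA v with h1 | h1
    · rw [degS_congr (H := B) fun y => by
        rw [symmDiff_adj]; have := degS_eq_zero_iff.1 h1 y; tauto]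
      exact hB v
    · have h2 := (hB v).resolve_right (hv v h1)
      rw [degS_congr (H := A) fun y => by
        rw [symmDiff_adj]; have := degS_eq_zero_iff.1 h2 y; tauto]
      exact hA v

theorem exists_edge_assignment [Finite α] (G : SimpleGraph α) (hG : ∀ v, Even (degS G v)) :
    ∃ f : G.edgeSet → (Σ _ : α, ℕ), Function.Injective f ∧
      ∀ e : G.edgeSet, (f e).1 ∈ (e : Sym2 α) ∧ (f e).2 < degS G (f e).1 / 2 := by
  classical
  have := Fintype.ofFinite α
  have hdeg : ∀ v, degS G v = G.degree v := fun v => by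
    unfold degS; rw [Set.ncard_eq_toFinset_card', ← SimpleGraph.card_neighborFinset_eq_degree]; rfl
  have hall := (Finset.all_card_le_biUnion_card_iff_exists_injective
    (fun e : G.edgeSet => (Finset.univ.filter (· ∈ (e : Sym2 α))).sigma
      fun v => Finset.range (degS G v / 2))).1 ?_
  · obtain ⟨f, hf, h⟩ := hall
    exact ⟨f, hf, fun e => by simpa using h e⟩
  · intro s
    set V : Finset α := Finset.univ.filter fun v => ∃ e ∈ s, v ∈ (e : Sym2 α) with hV
    have hU : s.biUnion (fun e : G.edgeSet => (Finset.univ.filter (· ∈ (e : Sym2 α))).sigma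
        fun v => Finset.range (degS G v / 2)) = V.sigma fun v => Finset.range (degS G v / 2) := by
      ext ⟨v, i⟩
      simp only [hV, Finset.mem_biUnion, Finset.mem_sigma, Finset.mem_filter, Finset.mem_univ,
        true_and, Finset.mem_range]
      exact ⟨fun ⟨e, h1, h2, h3⟩ => ⟨⟨e, h1, h2⟩, h3⟩, fun ⟨⟨e, h1, h2⟩, h3⟩ => ⟨e, h1, h2, h3⟩⟩
    rw [hU, Finset.card_sigma]
    simp only [Finset.card_range]
    have h1 : ∑ v ∈ V, degS G v = 2 * ∑ v ∈ V, degS G v / 2 := by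
      rw [Finset.mul_sum]
      exact Finset.sum_congr rfl fun v _ => (Nat.two_mul_div_two_of_even (hG v)).symm
    have h2 : ∑ v ∈ V, (s.filter fun e : G.edgeSet => v ∈ (e : Sym2 α)).card =
        ∑ e ∈ s, (V.filter fun v => v ∈ (e : Sym2 α)).card :=
      Finset.sum_card_bipartiteAbove_eq_sum_card_bipartiteBelow _
    have h3 : ∀ e ∈ s, (V.filter fun v => v ∈ (e : Sym2 α)).card = 2 := by
      intro e he
      rw [← Sym2.card_toFinset_of_not_isDiag _ (G.not_isDiag_of_mem_edgeSet e.2)]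
      congr 1
      ext v
      simp only [hV, Finset.mem_filter, Finset.mem_univ, true_and, Sym2.mem_toFinset]
      exact ⟨fun h => h.2, fun h => ⟨⟨e, he, h⟩, h⟩⟩
    have h4 : ∀ v, (s.filter fun e : G.edgeSet => v ∈ (e : Sym2 α)).card ≤ degS G v := by
      intro v
      rw [hdeg, ← SimpleGraph.card_incidenceFinset_eq_degree]
      refine Finset.card_le_card_of_injOn (fun e : G.edgeSet => (e : Sym2 α)) ?_
        (Subtype.val_injective.injOn)
      intro e he
      simp only [Finset.coe_filter, Set.mem_ofPred_eq] at he
      simp only [Finset.mem_coe, SimpleGraph.mem_incidenceFinset]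
      exact ⟨e.2, he.2⟩
    rw [Finset.sum_congr rfl h3, Finset.sum_const, smul_eq_mul] at h2
    have h5 := Finset.sum_le_sum fun v (_ : v ∈ V) => h4 v
    omega

/-- A graph with all degrees even has a balanced orientation. -/
theorem exists_orientation [Finite α] (G : SimpleGraph α) (hG : ∀ v, Even (degS G v)) :
    ∃ D : α → α → Prop, (∀ x y, D x y → G.Adj x y ∧ ¬ D y x) ∧
      (∀ x, 2 * {y | D x y}.ncard = degS G x) ∧ ∀ x, 2 * {y | D y x}.ncard = degS G x := by
  classical
  have := Fintype.ofFinite α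
  obtain ⟨f, hf, h⟩ := exists_edge_assignment G hG
  let D : α → α → Prop := fun x y => ∃ hxy : G.Adj x y, (f ⟨s(x, y), hxy⟩).1 = x
  have hanti : ∀ x y, D x y → ¬ D y x := by
    rintro x y ⟨hxy, h1⟩ ⟨hyx, h2⟩
    have : (⟨s(x, y), hxy⟩ : G.edgeSet) = ⟨s(y, x), hyx⟩ := by simp [Sym2.eq_swap]
    rw [this] at h1
    exact hxy.ne (h1.symm.trans h2)
  have htot : ∀ x y, G.Adj x y → D x y ∨ D y x := by
    intro x y hxy
    have h1 := (h ⟨s(x, y), hxy⟩).1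
    rw [Sym2.mem_iff] at h1
    rcases h1 with h1 | h1
    · exact Or.inl ⟨hxy, h1⟩
    · refine Or.inr ⟨hxy.symm, ?_⟩
      have : (⟨s(x, y), hxy⟩ : G.edgeSet) = ⟨s(y, x), hxy.symm⟩ := by simp [Sym2.eq_swap]
      rw [← this]; exact h1
  have hout : ∀ x, {y | D x y}.ncard ≤ degS G x / 2 := by
    intro x
    have : (Set.Iio (degS G x / 2)).ncard = degS G x / 2 := by
      rw [Set.ncard_eq_toFinset_card']; simp
    rw [← this]
    refine Set.ncard_le_ncard_of_injOn
      (fun y => if hxy : G.Adj x y then (f ⟨s(x, y), hxy⟩).2 else 0) ?_ ?_ (Set.toFinite _)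
    · rintro y ⟨hxy, h1⟩
      have := (h ⟨s(x, y), hxy⟩).2
      rw [h1] at this
      simpa [hxy] using this
    · rintro y ⟨hxy, h1⟩ z ⟨hxz, h2⟩ heq
      simp only [hxy, hxz, dif_pos] at heq
      have := hf (Sigma.ext (h1.trans h2.symm) (heq_of_eq heq))
      exact (Sym2.congr_right).1 (congrArg Subtype.val this)
  have hsum : ∀ x, {y | D x y}.ncard + {y | D y x}.ncard = degS G x := by
    intro x
    have hdisj : Disjoint {y | D x y} {y | D y x} :=
      Set.disjoint_left.2 fun y h1 h2 => hanti x y h1 h2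
    rw [← Set.ncard_union_eq hdisj]
    unfold degS
    congr 1
    ext y
    simp only [Set.mem_union, Set.mem_ofPred_eq, SimpleGraph.mem_neighborSet]
    exact ⟨fun h' => h'.elim (fun ⟨a, _⟩ => a) (fun ⟨a, _⟩ => a.symm), htot x y⟩
  have hle : ∀ x, {y | D x y}.ncard ≤ {y | D y x}.ncard := by
    intro x
    have h1 := hout x
    have h2 := hsum x
    have := hG x
    rw [Nat.even_iff] at this
    omega
  have htotal : ∑ x, {y | D x y}.ncard = ∑ x, {y | D y x}.ncard := by
    simp only [Set.ncard_eq_toFinset_card', Set.toFinset_ofPred]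
    exact Finset.sum_card_bipartiteAbove_eq_sum_card_bipartiteBelow (s := Finset.univ)
      (t := Finset.univ) D
  have heq := fun x =>
    (Finset.sum_eq_sum_iff_of_le fun x _ => hle x).1 htotal x (Finset.mem_univ x)
  refine ⟨D, fun x y hD => ⟨hD.1, hanti x y hD⟩, fun x => ?_, fun x => ?_⟩ <;>
    have h1 := heq x <;> have h2 := hsum x <;> omega

theorem degS_symmDiff_of_le [Finite α] {G A : SimpleGraph α} (h : A ≤ G) (v : α) :
    degS (G ∆ A) v + degS A v = degS G v := by
  unfold degS
  have hle : A.neighborSet v ⊆ G.neighborSet v := fun y hy => h hy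
  rw [neighborSet_symmDiff, symmDiff_of_ge hle]
  exact Set.ncard_sdiff_add_ncard_of_subset hle

/-- A graph with all degrees even and at most `2 * (k + 1)` contains a polycycle through all
vertices of degree `2 * (k + 1)`. -/
theorem exists_isPolycycle_le [Finite α] {G : SimpleGraph α} (hG : ∀ v, Even (degS G v)) {k : ℕ}
    (hd : ∀ v, degS G v ≤ 2 * (k + 1)) :
    ∃ A ≤ G, IsPolycycle A ∧ ∀ v, degS (G ∆ A) v ≤ 2 * k := by
  classical
  have := Fintype.ofFinite α
  obtain ⟨D, hD, hout, hin⟩ := exists_orientation G hG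
  have hout' : ∀ x, {y | D x y}.ncard ≤ k + 1 := fun x => by
    have := hout x
    have := hd x
    omega
  have hirr : ∀ x, ¬ D x x := fun x h => (hD x x h).2 h
  let t : α → Finset α := fun x =>
    Finset.univ.filter fun y => D x y ∨ (y = x ∧ {y | D x y}.ncard < k + 1)
  obtain ⟨f, hf, hft⟩ := (Finset.all_card_le_biUnion_card_iff_exists_injective t).1 (by
    intro s
    let w : α → α → ℕ := fun x y =>
      (if D x y then 1 else 0) + if y = x then k + 1 - {y | D x y}.ncard else 0
    have hw : ∀ x y, w x y ≠ 0 → y ∈ t x := by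
      intro x y h
      simp only [t, Finset.mem_filter, Finset.mem_univ, true_and]
      by_contra hc
      push Not at hc
      apply h
      by_cases hyx : y = x
      · have := hc.2 hyx
        simp only [w, hyx, hirr, if_true, if_false]
        omega
      · simp [w, hc.1, hyx]
    have hrow : ∀ x, ∑ y, w x y = k + 1 := by
      intro x
      have h1 := hout' x
      simp only [w, Finset.sum_add_distrib, Finset.sum_ite_eq', Finset.mem_univ, if_true,
        Finset.sum_boole, Nat.cast_id]
      have h2 : {y | D x y}.ncard = (Finset.univ.filter fun y => D x y).card := by
        rw [← Set.ncard_coe_finset]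
        simp
      omega
    have hcol : ∀ y, ∑ x, w x y = k + 1 := by
      intro y
      have h1 := hout' y
      have h2 := hout y
      rw [← hin y] at h2
      simp only [w, Finset.sum_add_distrib, Finset.sum_ite_eq, Finset.mem_univ, if_true,
        Finset.sum_boole, Nat.cast_id]
      simp only [Set.ncard_eq_toFinset_card', Set.toFinset_ofPred] at h1 h2 ⊢
      omega
    have h1 : s.card * (k + 1) = ∑ x ∈ s, ∑ y ∈ s.biUnion t, w x y := by
      rw [← smul_eq_mul, ← Finset.sum_const]
      refine Finset.sum_congr rfl fun x hx => ?_
      rw [← hrow x]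
      refine (Finset.sum_subset (Finset.subset_univ _) fun y _ hy => ?_).symm
      by_contra hc
      exact hy (Finset.mem_biUnion.2 ⟨x, hx, hw x y hc⟩)
    have h2 : ∑ y ∈ s.biUnion t, ∑ x ∈ s, w x y ≤ (s.biUnion t).card * (k + 1) := by
      rw [← smul_eq_mul, ← Finset.sum_const]
      refine Finset.sum_le_sum fun y _ => ?_
      rw [← hcol y]
      exact Finset.sum_le_sum_of_subset (Finset.subset_univ _)
    rw [Finset.sum_comm] at h1
    exact Nat.le_of_mul_le_mul_right (h1.trans_le h2) (Nat.succ_pos k))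
  have hft' : ∀ x, f x ≠ x → D x (f x) := by
    intro x hx
    have := hft x
    simp only [t, Finset.mem_filter, Finset.mem_univ, true_and] at this
    exact this.resolve_right fun h => hx h.1
  have hfull : ∀ x, f x = x → degS G x ≤ 2 * k := by
    intro x hx
    have := hft x
    simp only [t, Finset.mem_filter, Finset.mem_univ, true_and] at this
    rw [hx] at this
    have h1 := (this.resolve_left (hirr x)).2
    have := hout x
    omega
  have hsurj := Finite.surjective_of_injective hf
  let A : SimpleGraph α :=
    { Adj := fun x y => x ≠ y ∧ (f x = y ∨ f y = x)
      symm := ⟨fun x y h => ⟨h.1.symm, h.2.symm⟩⟩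
      loopless := ⟨fun x h => h.1 rfl⟩ }
  have hle : A ≤ G := by
    rintro x y ⟨hne, rfl | rfl⟩
    · exact (hD _ _ (hft' x hne.symm)).1
    · exact (hD _ _ (hft' y hne)).1.symm
  have h0 : ∀ v, f v = v → degS A v = 0 := by
    intro v hv
    refine degS_eq_zero_iff.2 ?_
    rintro y ⟨hne, h | h⟩
    · exact hne (hv.symm.trans h)
    · exact hne (hf (hv.trans h.symm))
  have h2 : ∀ v, f v ≠ v → degS A v = 2 := by
    intro v hv
    obtain ⟨w, hw⟩ := hsurj v
    have hwv : v ≠ w := by rintro rfl; exact hv hw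
    have hDw : D w v := by
      have := hft' w (by rw [hw]; exact hwv)
      rwa [hw] at this
    refine degS_eq_two_iff.2 ⟨f v, w, ?_, fun y => ⟨?_, ?_⟩⟩
    · rintro rfl
      exact (hD _ _ (hft' v hv)).2 hDw
    · rintro ⟨hne, h | h⟩
      · exact Or.inl h.symm
      · exact Or.inr (hf (h.trans hw.symm))
    · rintro (rfl | rfl)
      · exact ⟨hv.symm, Or.inl rfl⟩
      · exact ⟨hwv, Or.inr hw⟩
  refine ⟨A, hle, fun v => ?_, fun v => ?_⟩
  · by_cases hv : f v = v
    · exact Or.inl (h0 v hv)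
    · exact Or.inr (h2 v hv)
  · have h1 := degS_symmDiff_of_le hle v
    have h3 := hd v
    by_cases hv : f v = v
    · have := hfull v hv
      omega
    · have := h2 v hv
      omega

theorem degS_symmDiff_le [Finite α] (G H : SimpleGraph α) (v : α) :
    degS (G ∆ H) v ≤ degS G v + degS H v := by
  unfold degS
  rw [neighborSet_symmDiff]
  exact (Set.ncard_le_ncard symmDiff_le_sup).trans (Set.ncard_union_le _ _)

/-- The symmetric difference of two polycycles has an odd-cover by three paths. -/
theorem cov_three [Finite α] {A B : SimpleGraph α} (hA : IsPolycycle A) (hB : IsPolycycle B) :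
    Cov 3 (A ∆ B) := by
  have ho : oddSet (A ∆ B) = ∅ := by
    rw [oddSet_symmDiff, oddSet_of_isPolycycle hA, oddSet_of_isPolycycle hB, symmDiff_self]
    rfl
  obtain ⟨C, hle, hC, hd⟩ := exists_isPolycycle_le (G := A ∆ B) (k := 1)
    (fun v => by rw [← Nat.not_odd_iff_even, ← mem_oddSet, ho]; simp)
    (fun v => (degS_symmDiff_le A B v).trans
      (add_le_add (degS_le_two_of_isPolycycle hA v) (degS_le_two_of_isPolycycle hB v)))
  have hC' : IsPolycycle ((A ∆ B) ∆ C) := isPolycycle_of_oddSet hd (by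
    rw [oddSet_symmDiff, ho, oddSet_of_isPolycycle hC, symmDiff_self]
    rfl)
  have := cov_three_of_disjoint hC' hC (fun x y h1 h2 => by
    rw [symmDiff_adj] at h1
    exact h1.elim (fun h => h.2 h2) fun h => h.2 (hle h2))
  rwa [symmDiff_symmDiff_cancel_right] at this

theorem degS_option [Finite α] (H : SimpleGraph (Option α)) (v : α)
    [Decidable (H.Adj none (some v))] :
    degS H (some v) = degS (H.comap some) v + if H.Adj none (some v) then 1 else 0 := by
  have himg : (some '' (H.comap some).neighborSet v).ncard = degS (H.comap some) v :=
    Set.ncard_image_of_injective _ (Option.some_injective α)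
  rw [← himg]
  unfold degS
  split_ifs with h
  · rw [← Set.ncard_insert_of_notMem (a := none) (by simp)]
    congr 1
    ext (_ | y)
    · simpa using h.symm
    · simp
  · congr 1
    ext (_ | y)
    · simpa using fun h' => h (SimpleGraph.Adj.symm h')
    · simp

/-- The graph obtained by joining a new vertex to all vertices of odd degree. -/
def evenCone (G : SimpleGraph α) : SimpleGraph (Option α) where
  Adj
    | none, none => False
    | none, some y => y ∈ oddSet G
    | some x, none => x ∈ oddSet G
    | some x, some y => G.Adj x y
  symm := ⟨by
    rintro (_ | x) (_ | y) h
    · exact h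
    · exact h
    · exact h
    · exact SimpleGraph.Adj.symm h⟩
  loopless := ⟨by
    rintro (_ | x) h
    · exact h
    · exact G.loopless.irrefl x h⟩

theorem degS_evenCone_none (G : SimpleGraph α) : degS (evenCone G) none = (oddSet G).ncard := by
  rw [← Set.ncard_image_of_injective _ (Option.some_injective α)]
  unfold degS
  congr 1
  ext (_ | y)
  · simp [evenCone]
  · simp [evenCone]

theorem even_degS_evenCone [Finite α] (G : SimpleGraph α) (v : Option α) :
    Even (degS (evenCone G) v) := by
  classical
  rcases v with _ | v
  · rw [degS_evenCone_none]
    exact even_ncard_oddSet G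
  · rw [degS_option]
    have h1 : degS ((evenCone G).comap some) v = degS G v := rfl
    by_cases hv : (evenCone G).Adj none (some v)
    · rw [if_pos hv, h1]
      exact Odd.add_odd (show Odd (degS G v) from hv) odd_one
    · rw [if_neg hv, h1]
      exact Nat.not_odd_iff_even.1 (show ¬Odd (degS G v) from hv)

theorem degS_evenCone_le [Finite α] {G : SimpleGraph α} {k : ℕ} (hd : ∀ v, degS G v ≤ 2 * k)
    (v : α) :
    degS (evenCone G) (some v) ≤ 2 * k := by
  classical
  rw [degS_option]
  have h1 : degS ((evenCone G).comap some) v = degS G v := rfl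
  have h2 := hd v
  by_cases hv : (evenCone G).Adj none (some v)
  · rw [if_pos hv]
    have h3 : Odd (degS G v) := hv
    rw [Nat.odd_iff] at h3
    omega
  · rw [if_neg hv]
    omega

theorem exists_layer [Finite α] {G : SimpleGraph α} {k : ℕ} (hd : ∀ v, degS G v ≤ 2 * (k + 1))
    (ho : (oddSet G).ncard ≤ 2 * (k + 1)) :
    ∃ F : SimpleGraph α, (∀ v, degS F v ≤ 2) ∧ (∀ v, degS (G ∆ F) v ≤ 2 * k) ∧
      (IsPolycycle F ∧ (oddSet G).ncard ≤ 2 * k ∨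
        ∃ a b, a ≠ b ∧ oddSet F = {a, b} ∧ a ∈ oddSet G ∧ b ∈ oddSet G) := by
  classical
  obtain ⟨A, hle, hA, hdA⟩ := exists_isPolycycle_le (even_degS_evenCone G) (k := k) (by
    rintro (_ | v)
    · rw [degS_evenCone_none]; exact ho
    · exact degS_evenCone_le hd v)
  have hF : ∀ v, degS (A.comap some) v ≤ 2 := fun v => by
    have := degS_le_two_of_isPolycycle hA (some v)
    rw [degS_option] at this
    omega
  have hodd : ∀ v, v ∈ oddSet (A.comap some) ↔ A.Adj none (some v) := by
    intro v
    have h1 := degS_option A v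
    rw [mem_oddSet, Nat.odd_iff]
    split_ifs at h1 with h <;> rcases hA (some v) with h2 | h2 <;>
      simp only [h, iff_true, iff_false] <;> omega
  refine ⟨A.comap some, hF, fun v => ?_, ?_⟩
  · have h1 := hdA (some v)
    rw [degS_option] at h1
    have h2 : degS (G ∆ A.comap some) v = degS ((evenCone G ∆ A).comap some) v :=
      degS_congr fun y => by
        rw [SimpleGraph.comap_adj, symmDiff_adj, symmDiff_adj]
        exact Iff.rfl
    omega
  · rcases hA none with h0 | h2
    · refine Or.inl ⟨isPolycycle_of_oddSet hF ?_, ?_⟩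
      · ext v
        rw [hodd]
        simpa using degS_eq_zero_iff.1 h0 (some v)
      · have h1 := degS_symmDiff_of_le hle none
        have h3 := hdA none
        rw [degS_evenCone_none] at h1
        omega
    · obtain ⟨a, b, hab, hn⟩ := degS_eq_two_iff.1 h2
      have ha := (hn a).2 (Or.inl rfl)
      have hb := (hn b).2 (Or.inr rfl)
      rcases a with _ | a
      · exact (A.loopless.irrefl _ ha).elim
      rcases b with _ | b
      · exact (A.loopless.irrefl _ hb).elim
      refine Or.inr ⟨a, b, by simpa using hab, ?_, hle ha, hle hb⟩
      ext v
      rw [hodd, hn]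
      simp

/-- Graphs obtained by adding a polycycle. -/
def AddPoly (P : SimpleGraph α → Prop) (G : SimpleGraph α) : Prop :=
  ∃ A, IsPolycycle A ∧ P (G ∆ A)

/-- Graphs obtained by adding a graph of maximum degree two with exactly two odd vertices, both of
which were even before. -/
def AddLayer (P : SimpleGraph α → Prop) (G : SimpleGraph α) : Prop :=
  ∃ F a b, (∀ v, degS F v ≤ 2) ∧ a ≠ b ∧ oddSet F = {a, b} ∧ a ∉ oddSet (G ∆ F) ∧
    b ∉ oddSet (G ∆ F) ∧ P (G ∆ F)

/-- Graphs obtained by flipping an edge between two even vertices. -/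
def AddEdge (P : SimpleGraph α → Prop) (G : SimpleGraph α) : Prop :=
  ∃ c d, c ≠ d ∧ c ∉ oddSet (G ∆ SimpleGraph.edge c d) ∧ d ∉ oddSet (G ∆ SimpleGraph.edge c d) ∧
    P (G ∆ SimpleGraph.edge c d)

theorem monotone_addLayer : Monotone (AddLayer (α := α)) :=
  fun _ _ h _ ⟨F, a, b, h1, h2, h3, h4, h5, h6⟩ => ⟨F, a, b, h1, h2, h3, h4, h5, h _ h6⟩

theorem monotone_addEdge : Monotone (AddEdge (α := α)) :=
  fun _ _ h _ ⟨c, d, h1, h2, h3, h4⟩ => ⟨c, d, h1, h2, h3, h _ h4⟩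

theorem addPoly_addLayer_le [Finite α] (P : SimpleGraph α → Prop) :
    AddPoly (AddLayer P) ≤ AddLayer (AddPoly P) := by
  rintro G ⟨A, hA, F, a, b, h1, h2, h3, h4, h5, h6⟩
  have ho : oddSet (G ∆ A ∆ F) = oddSet (G ∆ F) := by
    rw [oddSet_symmDiff, oddSet_symmDiff, oddSet_symmDiff, oddSet_of_isPolycycle hA,
      ← Set.bot_eq_empty, symmDiff_bot]
  rw [ho] at h4 h5
  exact ⟨F, a, b, h1, h2, h3, h4, h5, A, hA, by rwa [symmDiff_right_comm]⟩

theorem addEdge_addLayer_le [Finite α] (P : SimpleGraph α → Prop) :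
    AddEdge (AddLayer P) ≤ AddLayer (AddEdge P) := by
  rintro G ⟨c, d, hcd, hc, hd, F, a, b, h1, h2, h3, h4, h5, h6⟩
  rw [symmDiff_right_comm] at h6
  simp only [oddSet_symmDiff, oddSet_edge hcd, h3, Set.mem_symmDiff, Set.mem_insert_iff,
    Set.mem_singleton_iff] at hc hd h4 h5
  refine ⟨F, a, b, h1, h2, h3, ?_, ?_, c, d, hcd, ?_, ?_, h6⟩ <;>
    simp only [oddSet_symmDiff, oddSet_edge hcd, h3, Set.mem_symmDiff, Set.mem_insert_iff,
    Set.mem_singleton_iff] <;> grind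

theorem map_iterate_le {β : Type*} [Preorder β] {f g : β → β} (hg : Monotone g)
    (h : ∀ P, f (g P) ≤ g (f P)) (n : ℕ) (P : β) : f (g^[n] P) ≤ g^[n] (f P) := by
  induction n with
  | zero => exact le_rfl
  | succ n ih =>
    rw [Function.iterate_succ_apply', Function.iterate_succ_apply']
    exact (h _).trans (hg ih)

theorem iterate_map_le {β : Type*} [Preorder β] {f g : β → β} (hf : Monotone f)
    (h : ∀ P, f (g P) ≤ g (f P)) (n : ℕ) (P : β) : f^[n] (g P) ≤ g (f^[n] P) := by
  induction n with
  | zero => exact le_rfl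
  | succ n ih =>
    rw [Function.iterate_succ_apply', Function.iterate_succ_apply']
    exact (hf ih).trans (h _)

theorem exists_layers [Finite α] (k : ℕ) : ∀ (w : ℕ) (G : SimpleGraph α), w ≤ k →
    (∀ v, degS G v ≤ 2 * k) → (oddSet G).ncard = 2 * w →
    AddLayer^[w] (AddPoly^[k - w] (· = ⊥)) G := by
  induction k with
  | zero =>
    intro w G hw hd _
    obtain rfl : w = 0 := by omega
    ext x y
    simpa using degS_eq_zero_iff.1 (Nat.le_zero.1 (hd x)) y
  | succ k ih =>
    intro w G hw hd ho
    obtain ⟨F, hF, hd', ⟨hpoly, hk⟩ | ⟨a, b, hab, hoF, ha, hb⟩⟩ := exists_layer hd (by omega)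
    · have h1 := ih w (G ∆ F) (by omega) hd' (by
        rw [oddSet_symmDiff, oddSet_of_isPolycycle hpoly, ← Set.bot_eq_empty, symmDiff_bot, ho])
      have h2 := map_iterate_le monotone_addLayer addPoly_addLayer_le w _ G ⟨F, hpoly, h1⟩
      rwa [← Function.iterate_succ_apply' AddPoly, show (k - w).succ = k + 1 - w by omega] at h2
    · have hs : oddSet (G ∆ F) = oddSet G \ {a, b} := by
        rw [oddSet_symmDiff, hoF]
        exact symmDiff_of_ge (Set.pair_subset ha hb)
      have hc := Set.ncard_sdiff_add_ncard_of_subset (Set.pair_subset ha hb)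
      rw [Set.ncard_pair hab, ho, ← hs] at hc
      obtain ⟨w, rfl⟩ : ∃ w', w = w' + 1 := ⟨w - 1, by omega⟩
      rw [Function.iterate_succ_apply', show k + 1 - (w + 1) = k - w by omega]
      exact ⟨F, a, b, hF, hab, hoF, by rw [hs]; simp, by rw [hs]; simp,
        ih w _ (by omega) hd' (by omega)⟩

theorem exists_edges_layers [Finite α] {k w : ℕ} (hw : w ≤ k) (m : ℕ) : ∀ G : SimpleGraph α,
    (∀ v, degS G v ≤ 2 * k) → (oddSet G).ncard = 2 * (w + m) →
    AddEdge^[m] (AddLayer^[w] (AddPoly^[k - w] (· = ⊥))) G := by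
  induction m with
  | zero => exact fun G hd ho => exists_layers k w G hw hd ho
  | succ m ih =>
    intro G hd ho
    obtain ⟨c, hc, d, hd', hcd⟩ := (Set.one_lt_ncard (Set.toFinite _)).1
      (show 1 < (oddSet G).ncard by omega)
    have hs : oddSet (G ∆ SimpleGraph.edge c d) = oddSet G \ {c, d} := by
      rw [oddSet_flip _ hcd]
      exact symmDiff_of_ge (Set.pair_subset hc hd')
    have hn := Set.ncard_sdiff_add_ncard_of_subset (Set.pair_subset hc hd')
    rw [Set.ncard_pair hcd, ho, ← hs] at hn
    rw [Function.iterate_succ_apply']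
    refine ⟨c, d, hcd, by rw [hs]; simp, by rw [hs]; simp, ih _ (fun v => ?_) (by omega)⟩
    have hdv := hd v
    have h1 := degS_symmDiff_le G (SimpleGraph.edge c d) v
    by_cases hv : v = c ∨ v = d
    · have h2 : v ∈ oddSet G := by rcases hv with rfl | rfl <;> assumption
      have h3 : degS (SimpleGraph.edge c d) v ≤ 1 := by
        refine degS_le_one_iff.2 fun y z hy hz => ?_
        rw [edge_adj' hcd] at hy hz
        grind
      rw [mem_oddSet, Nat.odd_iff] at h2
      omega
    · push Not at hv
      rw [degS_flip_of_ne hcd hv.1 hv.2]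
      exact hdv

theorem cov_of_add {m n : ℕ} {G H : SimpleGraph α} (h1 : Cov m H) (h2 : Cov n (G ∆ H)) :
    Cov (m + n) G := by
  have := h1.add h2
  rwa [symmDiff_comm G, symmDiff_symmDiff_cancel_left] at this

theorem cov_of_polys [Finite α] (z : ℕ) : ∀ G : SimpleGraph α, AddPoly^[z] (· = ⊥) G →
    Cov ((3 * z + 1) / 2) G := by
  induction z using Nat.twoStepInduction with
  | zero =>
    rintro G rfl
    exact cov_bot _
  | one =>
    rintro G ⟨A, hA, h⟩
    rw [symmDiff_eq_bot] at h
    rw [h]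
    exact cov_two_of_isPolycycle hA
  | more z ih _ =>
    intro G h
    rw [Function.iterate_succ_apply', Function.iterate_succ_apply'] at h
    obtain ⟨A, hA, B, hB, h⟩ := h
    rw [symmDiff_assoc] at h
    exact (cov_of_add (cov_three hA hB) (ih _ h)).mono (by omega)

theorem isPolycycle_layer_flip [Finite α] {F : SimpleGraph α} (hF : ∀ v, degS F v ≤ 2) {a b : α}
    (hab : a ≠ b) (ho : oddSet F = {a, b}) : IsPolycycle (F ∆ SimpleGraph.edge a b) := by
  refine isPolycycle_of_oddSet (fun v => ?_) ?_
  · by_cases hv : v = a ∨ v = b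
    · have h1 := degS_eq_one_of_mem_oddSet hF (v := v) (by rw [ho]; exact hv)
      have h2 := degS_symmDiff_le F (SimpleGraph.edge a b) v
      have h3 : degS (SimpleGraph.edge a b) v ≤ 1 := by
        refine degS_le_one_iff.2 fun y z hy hz => ?_
        rw [edge_adj' hab] at hy hz
        grind
      omega
    · push Not at hv
      rw [degS_flip_of_ne hab hv.1 hv.2]
      exact hF v
  · rw [oddSet_flip _ hab, ho, symmDiff_self]
    rfl

theorem cov_of_layers [Finite α] (w : ℕ) : ∀ (z : ℕ) (G : SimpleGraph α),
    AddLayer^[w] (AddPoly^[z] (· = ⊥)) G →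
    Cov (2 * ((w + 1) / 2) + (3 * (z + w / 2) + 1) / 2) G := by
  induction w using Nat.twoStepInduction with
  | zero => exact fun z G h => (cov_of_polys z G h).mono (by omega)
  | one =>
    rintro z G ⟨F, a, b, hF, hab, ho, -, -, h⟩
    exact (cov_of_add (cov_two_layer hF ho) (cov_of_polys z _ h)).mono (by omega)
  | more w ih _ =>
    intro z G h
    rw [Function.iterate_succ_apply', Function.iterate_succ_apply'] at h
    obtain ⟨F, a, b, hF, hab, ho, ha, hb, F', c, d, hF', hcd, ho', hc, hd, h⟩ := h
    have hnot : c ≠ a ∧ c ≠ b ∧ d ≠ a ∧ d ≠ b := by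
      simp only [oddSet_symmDiff, ho, ho', Set.mem_symmDiff, Set.mem_insert_iff,
        Set.mem_singleton_iff] at ha hb hc hd
      grind
    have h1 := map_iterate_le monotone_addLayer addPoly_addLayer_le w _
      (G ∆ (F ∆ SimpleGraph.edge c d))
      ⟨F' ∆ SimpleGraph.edge c d, isPolycycle_layer_flip hF' hcd ho', by
        rwa [symmDiff_assoc, flip_symmDiff_flip, ← symmDiff_assoc]⟩
    rw [← Function.iterate_succ_apply' AddPoly] at h1
    exact (cov_of_add (cov_two_layer_edge hF hab ho hcd hnot.1 hnot.2.1 hnot.2.2.1 hnot.2.2.2)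
      (ih _ _ h1)).mono (by omega)

theorem cov_of_edges_layers [Finite α] (z m : ℕ) : ∀ (w : ℕ) (G : SimpleGraph α),
    AddEdge^[m] (AddLayer^[w] (AddPoly^[z] (· = ⊥))) G →
    Cov (2 * min w m + (m - w) + 2 * ((w - m + 1) / 2) + (3 * (z + (w - m) / 2) + 1) / 2) G := by
  induction m with
  | zero => exact fun w G h => (cov_of_layers w z G h).mono (by simp)
  | succ m ih =>
    intro w G h
    rw [Function.iterate_succ_apply'] at h
    rcases w with _ | w
    · obtain ⟨c, d, hcd, -, -, h⟩ := h
      exact (cov_of_add (cov_edge hcd) (ih 0 _ h)).mono (by omega)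
    · rw [← Function.iterate_succ_apply' AddEdge, Function.iterate_succ_apply' AddLayer] at h
      have h1 := iterate_map_le monotone_addEdge addEdge_addLayer_le (m + 1) _ G h
      rw [Function.iterate_succ_apply'] at h1
      obtain ⟨F, a, b, hF, hab, ho, ha, hb, c, d, hcd, hc, hd, h⟩ := h1
      have hnot : c ≠ a ∧ c ≠ b ∧ d ≠ a ∧ d ≠ b := by
        simp only [oddSet_symmDiff, ho, oddSet_edge hcd, Set.mem_symmDiff, Set.mem_insert_iff,
          Set.mem_singleton_iff] at ha hb hc hd
        grind
      rw [symmDiff_assoc] at h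
      exact (cov_of_add (cov_two_layer_edge hF hab ho hcd hnot.1 hnot.2.1 hnot.2.2.1 hnot.2.2.2)
        (ih w _ h)).mono (by omega)

theorem cov_general [Fintype α] (G : SimpleGraph α) :
    Cov (max (vodd G / 2) ((vodd G / 2 + 3 * deltaE G + 3) / 4)) G := by
  have hd : ∀ v, degS G v ≤ 2 * ((maxDegS G + 1) / 2) := fun v => by
    have : degS G v ≤ maxDegS G := Finset.le_sup (Finset.mem_univ v)
    omega
  have hv : (oddSet G).ncard = vodd G := rfl
  have he := even_ncard_oddSet G
  rw [hv, Nat.even_iff] at he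
  unfold deltaE
  generalize (maxDegS G + 1) / 2 = k at hd ⊢
  by_cases htk : vodd G / 2 ≤ k
  · refine (cov_of_edges_layers _ 0 _ G (exists_edges_layers htk 0 G hd (by omega))).mono ?_
    generalize vodd G / 2 = w at htk ⊢
    obtain ⟨z, rfl⟩ := Nat.exists_eq_add_of_le htk
    obtain ⟨s, rfl | rfl⟩ := w.even_or_odd' <;> obtain ⟨t, ht | ht⟩ := (z + s).even_or_odd' <;>
      omega
  · refine (cov_of_edges_layers _ (vodd G / 2 - k) _ G
      (exists_edges_layers le_rfl _ G hd (by omega))).mono ?_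
    generalize vodd G / 2 = w at htk ⊢
    by_cases hw : w ≤ 2 * k
    · obtain ⟨m, rfl⟩ := Nat.exists_eq_add_of_le (not_le.1 htk).le
      obtain ⟨d, rfl⟩ := Nat.exists_eq_add_of_le (show m ≤ k by omega)
      obtain ⟨s, rfl | rfl⟩ := d.even_or_odd' <;> obtain ⟨t, rfl | rfl⟩ := s.even_or_odd' <;> omega
    · omega

theorem even_maxDegS [Fintype α] {G : SimpleGraph α} (hG : ∀ v, Even (degS G v)) :
    Even (maxDegS G) :=
  Finset.sup_induction (p := Even) (by simp) (fun a ha b hb => by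
    rcases max_choice a b with h | h <;> rw [h] <;> assumption) fun v _ => hG v

theorem cov_even [Fintype α] {G : SimpleGraph α} (hG : ∀ v, Even (degS G v)) :
    Cov ((3 * maxDegS G + 3) / 4) G := by
  have hv : vodd G = 0 := by
    unfold vodd
    rw [Set.ncard_eq_zero, Set.eq_empty_iff_forall_notMem]
    exact fun v hv => Nat.not_odd_iff_even.2 (hG v) hv
  have he := even_maxDegS hG
  have := cov_general G
  rw [hv] at this
  unfold deltaE at this
  rw [Nat.even_iff] at he
  exact this.mono (by omega)

end
end PathOddCover

/-- Every graph `G` admits a path odd-cover of size at most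
`max(v_odd(G)/2, ⌈(v_odd(G)/2 + 3Δₑ(G))/4⌉)`; in particular, an Eulerian graph
admits a path odd-cover of size at most `⌈3Δ(G)/4⌉`. -/
theorem path_oddCover_general
    {α : Type*} [Fintype α] (G : SimpleGraph α) :
    (∃ L : List (SimpleGraph α),
        L.length ≤ max (vodd G / 2) ((vodd G / 2 + 3 * deltaE G + 3) / 4) ∧
        (∀ P ∈ L, IsPathGraph P) ∧ listSymmDiff L = G) ∧
    ((∀ v, Even (degS G v)) →
      ∃ L : List (SimpleGraph α),
        L.length ≤ (3 * maxDegS G + 3) / 4 ∧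
        (∀ P ∈ L, IsPathGraph P) ∧ listSymmDiff L = G) :=
  ⟨PathOddCover.cov_general G, fun hG => PathOddCover.cov_even hG⟩
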